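/- arXiv:1906.11986 — 7 statements merged into one kernel-verified Lean document; each statement's English description precedes it below -/
import Mathlib

section
/- There exists a positive integer N₀ such that for all integers N ≥ N₀, the cardinality of 𝔈_N satisfies log(#𝔈_N) < 0.421·N. In particular, limsup_{N→∞} log(#𝔈_N)/N < 0.421. -/
open Finset

/-- The set of Egyptian fractions with denominators at most `N`:
`𝔈_N = { ∑_{n=1}^N t_n/n : t_n ∈ {0,1} }`. -/
def egyptianFractions (N : ℕ) : Finset ℚ :=
  (Finset.Icc 1 N).powerset.image (fun s : Finset ℕ => ∑ n ∈ s, (1 : ℚ) / (n : ℚ))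

/-- Denominators up to `N` that do not divide `lcm(1, …, N/20)`. -/
def badDenoms (N : ℕ) : Finset ℕ :=
  (Finset.Icc 1 N).filter (fun n => ¬ n ∣ Nat.lcmUpto (N / 20))

/-- A bad denominator is a multiple of the least power of some prime exceeding `N/20`. -/
theorem badDenoms_card (N : ℕ) : (badDenoms N).card ≤ Nat.primeCounting N * 20 := by
  have hsub : badDenoms N ⊆ (Nat.primesLE N ×ˢ Finset.range 20).image
      (fun x => x.1 ^ (Nat.log x.1 (N / 20) + 1) * x.2) := by
    intro n hn
    simp only [badDenoms, Finset.mem_filter, Finset.mem_Icc] at hn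
    obtain ⟨⟨h1, hN⟩, hnd⟩ := hn
    rw [← Nat.factorization_prime_le_iff_dvd (by omega) (Nat.lcmUpto_ne_zero _)] at hnd
    push Not at hnd
    obtain ⟨p, hp, hlt⟩ := hnd
    rw [Nat.factorization_lcmUpto _ hp] at hlt
    have hdvd : p ^ (Nat.log p (N / 20) + 1) ∣ n :=
      (hp.pow_dvd_iff_le_factorization (by omega)).2 hlt
    have hgt : N / 20 < p ^ (Nat.log p (N / 20) + 1) :=
      Nat.lt_pow_succ_log_self hp.one_lt _
    have hpn : p ≤ n := Nat.le_of_dvd (by omega) ((dvd_pow_self p (by omega)).trans hdvd)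
    obtain ⟨k, hk⟩ := hdvd
    simp only [Finset.mem_image, Finset.mem_product, Nat.mem_primesLE, Finset.mem_range,
      Prod.exists]
    refine ⟨p, k, ⟨⟨hpn.trans hN, hp⟩, ?_⟩, hk.symm⟩
    by_contra! hk20
    have : (N / 20 + 1) * 20 ≤ n := by
      rw [hk]
      exact Nat.mul_le_mul hgt hk20
    omega
  calc (badDenoms N).card ≤ _ := Finset.card_le_card hsub
    _ ≤ _ := Finset.card_image_le
    _ = _ := by rw [Finset.card_product, Finset.card_range, Nat.primesLE_card_eq_primeCounting]

theorem egyptian_card_le (N : ℕ) :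
    (egyptianFractions N).card ≤
      2 ^ (badDenoms N).card * (Nat.lcmUpto (N / 20) * N + 1) := by
  set L := Nat.lcmUpto (N / 20) with hL
  have hL0 : (L : ℚ) ≠ 0 := by exact_mod_cast Nat.lcmUpto_ne_zero _
  let f : Finset ℕ → ℚ := fun s => ∑ n ∈ s, (1 : ℚ) / (n : ℚ)
  have hsub : egyptianFractions N ⊆
      ((badDenoms N).powerset ×ˢ Finset.range (L * N + 1)).image
        (fun x => f x.1 + (x.2 : ℚ) / L) := by
    intro q hq
    simp only [egyptianFractions, Finset.mem_image, Finset.mem_powerset] at hq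
    obtain ⟨s, hs, rfl⟩ := hq
    simp only [Finset.mem_image, Finset.mem_product, Finset.mem_powerset, Finset.mem_range,
      Prod.exists]
    refine ⟨s.filter (fun n => ¬ n ∣ L), ∑ n ∈ s.filter (fun n => n ∣ L), L / n, ⟨?_, ?_⟩, ?_⟩
    · exact Finset.filter_subset_filter _ hs
    · refine Nat.lt_succ_of_le ?_
      calc ∑ n ∈ s.filter (fun n => n ∣ L), L / n
          ≤ ∑ n ∈ s.filter (fun n => n ∣ L), L :=
            Finset.sum_le_sum fun n _ => Nat.div_le_self _ _
        _ = (s.filter (fun n => n ∣ L)).card * L := by simp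
        _ ≤ N * L := by
            refine Nat.mul_le_mul_right _ ?_
            calc _ ≤ (Finset.Icc 1 N).card :=
                  Finset.card_le_card ((Finset.filter_subset _ _).trans hs)
              _ = N := by simp
        _ = L * N := Nat.mul_comm _ _
    · rw [← Finset.sum_filter_add_sum_filter_not s (fun n => n ∣ L), add_comm]
      congr 1
      rw [Nat.cast_sum, Finset.sum_div]
      refine Finset.sum_congr rfl fun n hn => ?_
      obtain ⟨hns, hd⟩ := Finset.mem_filter.1 hn
      have hn0 : (n : ℚ) ≠ 0 := by
        have := (Finset.mem_Icc.1 (hs hns)).1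
        exact_mod_cast (by omega : n ≠ 0)
      rw [Nat.cast_div hd hn0]
      field_simp
  calc _ ≤ _ := Finset.card_le_card hsub
    _ ≤ _ := Finset.card_image_le
    _ = _ := by rw [Finset.card_product, Finset.card_range, Finset.card_powerset]

theorem egyptian_log_le (N : ℕ) :
    Real.log (egyptianFractions N).card ≤
      20 * (Nat.primeCounting N : ℝ) + 0.27 * N + Real.log (N + 1) := by
  set L := Nat.lcmUpto (N / 20) with hL
  have hLpos : 0 < L := Nat.lcmUpto_pos _
  have hLR : (0 : ℝ) < L := by exact_mod_cast hLpos
  have hpos : 0 < (egyptianFractions N).card :=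
    Finset.card_pos.2 ((Finset.powerset_nonempty _).image _)
  have h1 : (egyptianFractions N).card ≤ 2 ^ (badDenoms N).card * (L * (N + 1)) := by
    refine (egyptian_card_le N).trans (Nat.mul_le_mul_left _ ?_)
    rw [← hL]
    nlinarith
  have h2 : ((egyptianFractions N).card : ℝ) ≤ 2 ^ (badDenoms N).card * (L * (N + 1)) := by
    exact_mod_cast h1
  have h3 := Real.log_le_log (by exact_mod_cast hpos) h2
  rw [Real.log_mul (by positivity) (by positivity), Real.log_mul (by positivity) (by positivity),
    Real.log_pow] at h3
  have h4 : ((badDenoms N).card : ℝ) ≤ Nat.primeCounting N * 20 := by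
    exact_mod_cast badDenoms_card N
  have hl2 : Real.log 2 < 0.7 := by linarith [Real.log_two_lt_d9]
  have hl4 : Real.log 4 = 2 * Real.log 2 := by
    rw [show (4 : ℝ) = 2 ^ 2 by norm_num, Real.log_pow]; norm_num
  have h5 : ((badDenoms N).card : ℝ) * Real.log 2 ≤ (badDenoms N).card := by
    have : (0 : ℝ) ≤ (badDenoms N).card := by positivity
    nlinarith
  have h6 : Real.log L ≤ (Real.log 4 + 4) * ((N / 20 : ℕ) : ℝ) := by
    rw [hL, ← Chebyshev.psi_eq_log_lcmUpto]
    exact Chebyshev.psi_le_const_mul_self (by positivity)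
  have h7 : ((N / 20 : ℕ) : ℝ) ≤ N / 20 := by
    have := @Nat.cast_div_le ℝ _ _ _ N 20
    exact_mod_cast this
  have h8 : (Real.log 4 + 4) * ((N / 20 : ℕ) : ℝ) ≤ 5.4 * (N / 20) :=
    mul_le_mul (by linarith) h7 (by positivity) (by norm_num)
  linarith

theorem egyptian_eventually :
    ∀ᶠ N : ℕ in Filter.atTop, Real.log (egyptianFractions N).card ≤ 0.4 * N := by
  have hpi := tendsto_natCast_atTop_atTop.eventually
    (Chebyshev.eventually_primeCounting_le (ε := 1) one_pos)
  have hlog := (Real.tendsto_log_atTop.comp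
    (tendsto_natCast_atTop_atTop (R := ℝ))).eventually_ge_atTop 960
  have hlog2 := (tendsto_natCast_atTop_atTop (R := ℝ)).eventually
    (Real.isLittleO_log_id_atTop.bound (show (0 : ℝ) < 0.01 by norm_num))
  filter_upwards [hpi, hlog, hlog2, Filter.eventually_ge_atTop 100] with N h1 h2 h3 h4
  have hN : (100 : ℝ) ≤ N := by exact_mod_cast h4
  rw [Nat.floor_natCast] at h1
  simp only [Function.comp] at h2
  simp only [id, Real.norm_eq_abs] at h3
  rw [abs_of_nonneg (by linarith), abs_of_nonneg (by linarith)] at h3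
  have hl2 : Real.log 2 < 0.7 := by linarith [Real.log_two_lt_d9]
  have hl4 : Real.log 4 = 2 * Real.log 2 := by
    rw [show (4 : ℝ) = 2 ^ 2 by norm_num, Real.log_pow]; norm_num
  have h5 : (Real.log 4 + 1) * N / Real.log N ≤ 2.4 * N / 960 := by
    apply div_le_div₀ (by positivity) _ (by norm_num) h2
    exact mul_le_mul_of_nonneg_right (by linarith) (by linarith)
  have h6 : Real.log (N + 1) ≤ Real.log 2 + Real.log N := by
    rw [← Real.log_mul (by norm_num) (by linarith)]
    exact Real.log_le_log (by linarith) (by linarith)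
  have := egyptian_log_le N
  linarith

theorem egyptian_upper_bound :
    (∃ N₀ : ℕ, 0 < N₀ ∧ ∀ N : ℕ, N₀ ≤ N →
      Real.log (egyptianFractions N).card < 0.421 * N) ∧
    Filter.atTop.limsup
      (fun N : ℕ => Real.log (egyptianFractions N).card / N) < 0.421 := by
  constructor
  · obtain ⟨N₁, h⟩ := Filter.eventually_atTop.1 egyptian_eventually
    refine ⟨N₁ + 1, by omega, fun N hN => ?_⟩
    have h1 := h N (by omega)
    have h2 : (0 : ℝ) < N := by exact_mod_cast (by omega : 0 < N)
    linarith
  · refine lt_of_le_of_lt (Filter.limsup_le_of_le (a := (0.4 : ℝ)) ?_ ?_) (by norm_num)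
    · refine Filter.IsCoboundedUnder.of_frequently_ge (a := 0) ?_
      refine Filter.Frequently.of_forall fun N => ?_
      exact div_nonneg (Real.log_natCast_nonneg _) (Nat.cast_nonneg _)
    · filter_upwards [egyptian_eventually, Filter.eventually_gt_atTop 0] with N h1 h2
      rw [div_le_iff₀ (by exact_mod_cast h2)]
      exact h1
end

section
/- For every integer k ≥ 3 there exists N₀ (depending on k) such that for all integers N ≥ N₀, log(#𝔈_N) > (N/log N)·∏_{j=3}^{k} log_j N, where log_j denotes the j-th iterated logarithm. -/
open Finset

lemma egy_mem {M : ℕ} {x : ℚ} : x ∈ egyptianFractions M ↔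
    ∃ S ⊆ Finset.Icc 1 M, ∑ n ∈ S, (1 : ℚ) / (n : ℚ) = x := by
  simp [egyptianFractions]

lemma egy_mono {M N : ℕ} (h : M ≤ N) : egyptianFractions M ⊆ egyptianFractions N := by
  intro x hx
  rw [egy_mem] at hx ⊢
  obtain ⟨S, hS, rfl⟩ := hx
  exact ⟨S, hS.trans (Finset.Icc_subset_Icc_right h), rfl⟩

lemma egy_card_pos (M : ℕ) : 0 < (egyptianFractions M).card := by
  rw [Finset.card_pos]
  exact ⟨0, egy_mem.2 ⟨∅, by simp, by simp⟩⟩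

lemma egy_int {M K : ℕ} (hMK : M ≤ K) {x : ℚ} (hx : x ∈ egyptianFractions M) :
    ∃ z : ℕ, (z : ℚ) = (K.factorial : ℚ) * x ∧ z ≤ K * K.factorial := by
  rw [egy_mem] at hx
  obtain ⟨S, hS, rfl⟩ := hx
  refine ⟨∑ n ∈ S, K.factorial / n, ?_, ?_⟩
  · push_cast
    rw [Finset.mul_sum]
    refine Finset.sum_congr rfl fun n hn => ?_
    have := Finset.mem_Icc.1 (hS hn)
    rw [Nat.cast_div (Nat.dvd_factorial (by omega) (by omega))]
    · ring
    · have : n ≠ 0 := by omega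
      exact_mod_cast this
  · calc ∑ n ∈ S, K.factorial / n ≤ ∑ n ∈ S, K.factorial :=
          Finset.sum_le_sum fun n _ => Nat.div_le_self _ _
      _ = S.card * K.factorial := by simp
      _ ≤ K * K.factorial := by
          gcongr
          calc S.card ≤ (Finset.Icc 1 M).card := Finset.card_le_card hS
            _ = M := by simp
            _ ≤ K := hMK

lemma egy_norm {K q : ℕ} [hq : Fact q.Prime] (hK : K * K.factorial < q) {M : ℕ} (hM : M ≤ K) {x y : ℚ}
    (hx : x ∈ egyptianFractions M) (hy : y ∈ egyptianFractions M) :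
    padicNorm q (x - y) ≤ 1 ∧ (x ≠ y → padicNorm q (x - y) = 1) := by
  obtain ⟨z, hz, hz'⟩ := egy_int hM hx
  obtain ⟨w, hw, hw'⟩ := egy_int hM hy
  have hKq : K < q := lt_of_le_of_lt (Nat.le_mul_of_pos_right _ (Nat.factorial_pos K)) hK
  have hf : padicNorm q (K.factorial : ℚ) = 1 := by
    rw [padicNorm.nat_eq_one_iff, hq.out.dvd_factorial]
    omega
  have hmul : padicNorm q (((z : ℤ) - (w : ℤ) : ℤ) : ℚ) = padicNorm q (x - y) := by
    have : (((z : ℤ) - (w : ℤ) : ℤ) : ℚ) = (K.factorial : ℚ) * (x - y) := by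
      push_cast
      rw [hz, hw]; ring
    rw [this, padicNorm.mul, hf, one_mul]
  refine ⟨hmul ▸ padicNorm.of_int _, fun hne => ?_⟩
  rw [← hmul, padicNorm.int_eq_one_iff]
  intro hdvd
  have h0 : (z : ℤ) - w = 0 := by
    apply Int.eq_zero_of_abs_lt_dvd hdvd
    rw [abs_lt]
    constructor <;> omega
  have hzw : (z : ℚ) = w := by
    have : z = w := by omega
    rw [this]
  rw [hz, hw] at hzw
  exact hne (mul_left_cancel₀ (by positivity) hzw)

lemma egy_key (N K : ℕ) (Q : Finset ℕ) (M : ℕ → ℕ) (hQ : ∀ q ∈ Q, q.Prime)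
    (hMK : ∀ q ∈ Q, M q ≤ K) (hK : ∀ q ∈ Q, K * K.factorial < q)
    (hMN : ∀ q ∈ Q, q * M q ≤ N) :
    ∏ q ∈ Q, (egyptianFractions (M q)).card ≤ (egyptianFractions N).card := by
  classical
  have hKq : ∀ q ∈ Q, K < q := fun q hq =>
    lt_of_le_of_lt (Nat.le_mul_of_pos_right _ (Nat.factorial_pos K)) (hK q hq)
  rw [← Finset.card_pi]
  apply Finset.card_le_card_of_injOn
    (fun f : (∀ q ∈ Q, ℚ) => ∑ q ∈ Q.attach, f q.1 q.2 / (q.1 : ℚ))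
  · intro f hf
    have hf := Finset.mem_pi.1 hf
    have : ∀ q : Q, ∃ S ⊆ Finset.Icc 1 (M q.1), ∑ n ∈ S, (1 : ℚ) / (n : ℚ) = f q.1 q.2 :=
      fun q => egy_mem.1 (hf q.1 q.2)
    choose S hS hS' using this
    refine egy_mem.2 ⟨Q.attach.biUnion fun q => (S q).image (fun m => q.1 * m), ?_, ?_⟩
    · intro n hn
      simp only [Finset.mem_biUnion, Finset.mem_image] at hn
      obtain ⟨q, -, m, hm, rfl⟩ := hn
      have h1 := Finset.mem_Icc.1 (hS q hm)
      have h2 := hMN q.1 q.2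
      have h3 := (hQ q.1 q.2).pos
      rw [Finset.mem_Icc]
      constructor
      · exact Nat.mul_pos h3 h1.1
      · exact (Nat.mul_le_mul_left _ h1.2).trans h2
    · rw [Finset.sum_biUnion]
      · refine Finset.sum_congr rfl fun q _ => ?_
        have h3 := (hQ q.1 q.2).pos
        rw [Finset.sum_image (fun a _ b _ h => Nat.eq_of_mul_eq_mul_left h3 h), ← hS' q,
          Finset.sum_div]
        refine Finset.sum_congr rfl fun m _ => ?_
        push_cast
        rw [div_div, mul_comm]
      · intro p _ q _ hpq
        rw [Function.onFun, Finset.disjoint_left]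
        intro n hn hn'
        simp only [Finset.mem_image] at hn hn'
        obtain ⟨m, hm, rfl⟩ := hn
        obtain ⟨m', hm', he⟩ := hn'
        have h1 := Finset.mem_Icc.1 (hS p hm)
        have h2 := hMK p.1 p.2
        have hd : q.1 ∣ p.1 * m := ⟨m', he.symm⟩
        rcases (hQ q.1 q.2).dvd_mul.1 hd with h | h
        · exact hpq (Subtype.ext ((Nat.prime_dvd_prime_iff_eq (hQ q.1 q.2) (hQ p.1 p.2)).1 h).symm)
        · have := Nat.le_of_dvd h1.1 h
          have := hKq q.1 q.2
          omega
  · intro f hf g hg hfg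
    have hf := Finset.mem_pi.1 hf
    have hg := Finset.mem_pi.1 hg
    funext q hq
    by_contra hne
    have : Fact q.Prime := ⟨hQ q hq⟩
    have hz : ∑ p ∈ Q.attach, (f p.1 p.2 - g p.1 p.2) / (p.1 : ℚ) = 0 := by
      simp only [sub_div, Finset.sum_sub_distrib]
      exact sub_eq_zero.2 hfg
    rw [← Finset.add_sum_erase _ _ (Finset.mem_attach Q ⟨q, hq⟩)] at hz
    have h1 : padicNorm q (∑ p ∈ Q.attach.erase ⟨q, hq⟩, (f p.1 p.2 - g p.1 p.2) / (p.1 : ℚ)) ≤ 1 := by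
      apply padicNorm.sum_le' _ zero_le_one
      intro p hp
      have hpq : p.1 ≠ q := fun h => (Finset.mem_erase.1 hp).1 (Subtype.ext h)
      have : Fact p.1.Prime := ⟨hQ p.1 p.2⟩
      rw [padicNorm.div, padicNorm.padicNorm_of_prime_of_ne hpq.symm, div_one]
      exact (egy_norm (hK q hq) (hMK p.1 p.2) (hf p.1 p.2) (hg p.1 p.2)).1
    have h2 := (egy_norm (hK q hq) (hMK q hq) (hf q hq) (hg q hq)).2 hne
    have h3 : padicNorm q ((f q hq - g q hq) / (q : ℚ)) = q := by
      rw [padicNorm.div, h2, padicNorm.padicNorm_p_of_prime]; simp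
    rw [eq_neg_of_add_eq_zero_right hz, padicNorm.neg, h3] at h1
    have : 1 < q := (hQ q hq).one_lt
    have h4 : (1 : ℚ) < q := by exact_mod_cast this
    linarith

lemma egy_key_log (N K : ℕ) (Q : Finset ℕ) (M : ℕ → ℕ) (hQ : ∀ q ∈ Q, q.Prime)
    (hMK : ∀ q ∈ Q, M q ≤ K) (hK : ∀ q ∈ Q, K * K.factorial < q)
    (hMN : ∀ q ∈ Q, q * M q ≤ N) :
    ∑ q ∈ Q, Real.log (egyptianFractions (M q)).card ≤ Real.log (egyptianFractions N).card := by
  rw [← Real.log_prod (fun q _ => by exact_mod_cast (egy_card_pos (M q)).ne')]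
  apply Real.log_le_log
  · exact Finset.prod_pos fun q _ => by exact_mod_cast egy_card_pos (M q)
  · exact_mod_cast egy_key N K Q M hQ hMK hK hMN

lemma egy_log_mono {M N : ℕ} (h : M ≤ N) :
    Real.log (egyptianFractions M).card ≤ Real.log (egyptianFractions N).card :=
  Real.log_le_log (by exact_mod_cast egy_card_pos M)
    (by exact_mod_cast Finset.card_le_card (egy_mono h))

open Filter in
lemma egy_primes : ∀ᶠ n : ℕ in atTop,
    (1 / 10 : ℝ) * n / Real.log n ≤ ((Finset.Ioc (n / 4) n).filter Nat.Prime).card := by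
  have e1 : ∀ᶠ x : ℝ in atTop, Real.log x ≤ (1 / 100 : ℝ) * x ^ (1 / 2 : ℝ) := by
    have := (isLittleO_log_rpow_atTop (r := 1 / 2) (by norm_num)).bound
      (show (0 : ℝ) < 1 / 100 by norm_num)
    filter_upwards [this, eventually_ge_atTop 1] with x hx h1
    rw [Real.norm_of_nonneg (Real.log_nonneg h1), Real.norm_of_nonneg (by positivity)] at hx
    exact hx
  have e2 := tendsto_natCast_atTop_atTop (R := ℝ) |>.eventually e1
  filter_upwards [e2, eventually_ge_atTop 16] with n hn h16
  rw [← Real.sqrt_eq_rpow] at hn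
  have hnR : (16 : ℝ) ≤ n := by exact_mod_cast h16
  have hlogpos : 0 < Real.log n := Real.log_pos (by linarith)
  have hs : √(n : ℝ) * √(n : ℝ) = n := Real.mul_self_sqrt (by linarith)
  have hs0 : 0 ≤ √(n : ℝ) := Real.sqrt_nonneg _
  have hs1 : 1 ≤ √(n : ℝ) := by
    rw [Real.one_le_sqrt]; linarith
  have h1 := Chebyshev.theta_ge n
  have h2 : Real.log ((n : ℝ) + 1) ≤ Real.log n + 1 / 16 := by
    have : Real.log ((n : ℝ) + 1) = Real.log n + Real.log (1 + 1 / n) := by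
      rw [← Real.log_mul (by positivity) (by positivity)]
      congr 1; field_simp
    rw [this]
    have h3 := Real.log_le_sub_one_of_pos (show (0 : ℝ) < 1 + 1 / n by positivity)
    have h4 : (1 : ℝ) / n ≤ 1 / 16 := one_div_le_one_div_of_le (by norm_num) hnR
    linarith
  have h3 := Chebyshev.theta_le_log4_mul_x (x := (n : ℝ) / 4) (by positivity)
  have h4 : Real.log 4 = 2 * Real.log 2 := by
    rw [show (4 : ℝ) = 2 ^ 2 by norm_num, Real.log_pow]; norm_num
  have h5 := Real.log_two_gt_d9
  have h6 : Chebyshev.theta n - Chebyshev.theta ((n : ℝ) / 4)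
      ≤ ((Finset.Ioc (n / 4) n).filter Nat.Prime).card * Real.log n := by
    rw [Chebyshev.theta_eq_theta_coe_floor ((n : ℝ) / 4)]
    have hfl : ⌊(n : ℝ) / 4⌋₊ = n / 4 := by
      have := Nat.floor_div_natCast (K := ℝ) (n : ℝ) 4
      simpa using this
    rw [hfl]
    unfold Chebyshev.theta
    rw [Nat.floor_natCast, Nat.floor_natCast, sub_le_iff_le_add]
    have hun : (Finset.Ioc 0 n).filter Nat.Prime =
        (Finset.Ioc (n / 4) n).filter Nat.Prime ∪ (Finset.Ioc 0 (n / 4)).filter Nat.Prime := by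
      rw [← Finset.filter_union, Finset.union_comm,
        Finset.Ioc_union_Ioc_eq_Ioc (by omega) (by omega)]
    rw [hun, Finset.sum_union]
    · gcongr
      rw [← nsmul_eq_mul]
      apply Finset.sum_le_card_nsmul
      intro p hp
      have hp := Finset.mem_filter.1 hp
      apply Real.log_le_log
      · exact_mod_cast hp.2.pos
      · exact_mod_cast (Finset.mem_Ioc.1 hp.1).2
    · apply Finset.disjoint_filter_filter
      rw [Finset.disjoint_left]
      intro a ha hb
      rw [Finset.mem_Ioc] at ha hb
      omega
  rw [div_le_iff₀ hlogpos]
  have h7 : √(n : ℝ) * Real.log n ≤ 1 / 100 * n := by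
    calc √(n : ℝ) * Real.log n ≤ √(n : ℝ) * (1 / 100 * √(n : ℝ)) := by gcongr
      _ = 1 / 100 * (√(n : ℝ) * √(n : ℝ)) := by ring
      _ = _ := by rw [hs]
  have h8 : Real.log n ≤ 1 / 100 * n := by nlinarith
  have h9 : 0.69 * (n : ℝ) ≤ Real.log 2 * n := by
    apply mul_le_mul_of_nonneg_right _ (by positivity)
    norm_num at h5 ⊢; linarith
  rw [h4] at h3
  nlinarith

/-- Product of the first `k` iterated logarithms of `u`. -/
noncomputable def egP (k : ℕ) (u : ℝ) : ℝ := ∏ j ∈ Finset.range k, Real.log^[j + 1] u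

lemma egP_succ (k : ℕ) (u : ℝ) : egP (k + 1) u = Real.log u * egP k (Real.log u) := by
  unfold egP
  rw [Finset.prod_range_succ', mul_comm]
  simp [Function.iterate_succ_apply]

open Filter in
lemma egy_iter_tendsto (j : ℕ) : Tendsto (fun x : ℝ => Real.log^[j] x) atTop atTop := by
  induction j with
  | zero => exact tendsto_id
  | succ j ih =>
    simp only [Function.iterate_succ_apply']
    exact Real.tendsto_log_atTop.comp ih

open Filter in
lemma egy_iter_quarter (j : ℕ) :
    ∀ᶠ w : ℝ in atTop, ∀ v : ℝ, w / 4 ≤ v → Real.log^[j] w / 4 ≤ Real.log^[j] v := by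
  induction j with
  | zero => exact Eventually.of_forall fun w v h => by simpa using h
  | succ j ih =>
    have e1 := (egy_iter_tendsto j).eventually_ge_atTop 1
    have e2 := (egy_iter_tendsto (j + 1)).eventually_ge_atTop (2 * Real.log 4)
    filter_upwards [ih, e1, e2] with w hw h1 h2 v hv
    simp only [Function.iterate_succ_apply'] at h2 ⊢
    have h3 := hw v hv
    have h4 : Real.log (Real.log^[j] w / 4) ≤ Real.log (Real.log^[j] v) :=
      Real.log_le_log (by linarith) h3
    rw [Real.log_div (by linarith) (by norm_num)] at h4
    have : 0 < Real.log 4 := Real.log_pos (by norm_num)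
    linarith

open Filter in
lemma egP_pos (k : ℕ) : ∀ᶠ w : ℝ in atTop, 0 < egP k w := by
  have : ∀ᶠ w : ℝ in atTop, ∀ j ∈ Finset.range k, 0 < Real.log^[j + 1] w := by
    rw [Filter.eventually_all_finset]
    exact fun j _ => (egy_iter_tendsto (j + 1)).eventually_gt_atTop 0
  filter_upwards [this] with w hw
  exact Finset.prod_pos hw

open Filter in
lemma egP_quarter (k : ℕ) :
    ∀ᶠ w : ℝ in atTop, ∀ v : ℝ, w / 4 ≤ v → (1 / 4 : ℝ) ^ k * egP k w ≤ egP k v := by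
  have h1 : ∀ᶠ w : ℝ in atTop, ∀ j ∈ Finset.range k, 0 < Real.log^[j + 1] w := by
    rw [Filter.eventually_all_finset]
    exact fun j _ => (egy_iter_tendsto (j + 1)).eventually_gt_atTop 0
  have h2 : ∀ᶠ w : ℝ in atTop, ∀ j ∈ Finset.range k,
      ∀ v : ℝ, w / 4 ≤ v → Real.log^[j + 1] w / 4 ≤ Real.log^[j + 1] v := by
    rw [Filter.eventually_all_finset]
    exact fun j _ => egy_iter_quarter (j + 1)
  filter_upwards [h1, h2] with w h1 h2 v hv
  unfold egP
  calc (1 / 4 : ℝ) ^ k * ∏ j ∈ Finset.range k, Real.log^[j + 1] w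
      = ∏ j ∈ Finset.range k, (1 / 4 : ℝ) * Real.log^[j + 1] w := by
        rw [Finset.prod_mul_distrib]; simp
    _ ≤ _ := by
        apply Finset.prod_le_prod
        · intro j hj
          have := h1 j hj
          positivity
        · intro j hj
          have := h2 j hj v hv
          linarith

lemma egy_harm (a b : ℕ) (ha : 1 ≤ a) (hab : a ≤ b) :
    Real.log b - Real.log a ≤ ∑ i ∈ Finset.Ico a b, (1 : ℝ) / i := by
  induction b, hab using Nat.le_induction with
  | base => simp
  | succ b hb ih =>
    rw [Finset.sum_Ico_succ_top hb]
    have hb0 : (0 : ℝ) < b := by exact_mod_cast (by omega : 0 < b)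
    have h1 : Real.log ((b + 1 : ℕ) : ℝ) = Real.log b + Real.log (1 + 1 / b) := by
      rw [← Real.log_mul (by positivity) (by positivity)]
      congr 1; push_cast; field_simp
    have h2 := Real.log_le_sub_one_of_pos (show (0 : ℝ) < 1 + 1 / b by positivity)
    linarith

lemma egy_step_fixed (k n0 N s : ℕ) (c L : ℝ) (hc : 0 < c)
    (hprime : ∀ n : ℕ, n0 ≤ n →
      (1 / 10 : ℝ) * n / Real.log n ≤ ((Finset.Ioc (n / 4) n).filter Nat.Prime).card)
    (hind : ∀ M : ℕ, n0 ≤ M →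
      c * ((M : ℝ) / Real.log M) * egP k (Real.log (Real.log M)) ≤
        Real.log (egyptianFractions M).card)
    (hs : n0 ≤ s) (hs2 : 2 ≤ s) (hL : L / 4 ≤ Real.log s) (hP : 0 < egP k L)
    (hPq : ∀ v : ℝ, L / 4 ≤ v → (1 / 4 : ℝ) ^ k * egP k L ≤ egP k v)
    (hN : 4 ^ (s ^ 2) * (4 ^ (s ^ 2) * (4 ^ (s ^ 2)).factorial) ≤ N) :
    (c * (1 / 4) ^ k / (80 * Real.log 4)) * ((N : ℝ) / Real.log N) * (L * egP k L) ≤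
      Real.log (egyptianFractions N).card := by
  set K : ℕ := 4 ^ (s ^ 2) with hKdef
  have hKpos : 0 < K := by positivity
  have hKs : s ≤ K := by
    calc s ≤ s ^ 2 := by nlinarith
      _ ≤ K := (Nat.lt_pow_self (by norm_num)).le
  have hKKN : K * K ≤ N := by
    refine le_trans ?_ hN
    gcongr
    exact Nat.le_mul_of_pos_right _ (Nat.factorial_pos K)
  have hpow : ∀ i ∈ Finset.Ico s (s ^ 2), 4 ^ (i + 1) ≤ K := by
    intro i hi
    exact Nat.pow_le_pow_right (by norm_num) (Finset.mem_Ico.1 hi).2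
  have hlog4 : 0 < Real.log 4 := Real.log_pos (by norm_num)
  have hlog4' : 1 ≤ Real.log 4 := by
    rw [show (4 : ℝ) = 2 ^ 2 by norm_num, Real.log_pow]
    have := Real.log_two_gt_d9
    norm_num at this ⊢; linarith
  have hN4 : 4 ≤ N := by nlinarith
  have hlogN : 0 < Real.log N := Real.log_pos (by exact_mod_cast (by omega : 1 < N))
  let Qi : ℕ → Finset ℕ := fun i => (Finset.Ioc (N / 4 ^ i / 4) (N / 4 ^ i)).filter Nat.Prime
  have hQi : ∀ i q, q ∈ Qi i → N < q * 4 ^ (i + 1) ∧ q * 4 ^ i ≤ N ∧ q.Prime := by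
    intro i q hq
    have hq := Finset.mem_filter.1 hq
    have h1 := Finset.mem_Ioc.1 hq.1
    refine ⟨?_, ?_, hq.2⟩
    · rw [Nat.div_div_eq_div_mul, ← pow_succ, Nat.div_lt_iff_lt_mul (by positivity)] at h1
      exact h1.1
    · exact (Nat.le_div_iff_mul_le (by positivity)).1 h1.2
  have hdisj : Set.PairwiseDisjoint (↑(Finset.Ico s (s ^ 2))) Qi := by
    have key : ∀ i j q, q ∈ Qi i → q ∈ Qi j → i < j → False := by
      intro i j q hi hj hij
      have h1 := (hQi i q hi).1
      have h2 := (hQi j q hj).2.1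
      have h3 : 4 ^ (i + 1) ≤ 4 ^ j := Nat.pow_le_pow_right (by norm_num) hij
      have := Nat.mul_le_mul_left q h3
      omega
    intro i _ j _ hij
    rw [Function.onFun, Finset.disjoint_left]
    intro q hi hj
    rcases lt_or_gt_of_ne hij with h | h
    · exact key i j q hi hj h
    · exact key j i q hj hi h
  have hall : ∀ q ∈ (Finset.Ico s (s ^ 2)).biUnion Qi, q.Prime ∧ N < q * K := by
    intro q hq
    obtain ⟨i, hi, hq⟩ := Finset.mem_biUnion.1 hq
    have h := hQi i q hq
    exact ⟨h.2.2, h.1.trans_le (Nat.mul_le_mul_left _ (hpow i hi))⟩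
  have hmain := egy_key_log N K ((Finset.Ico s (s ^ 2)).biUnion Qi) (fun q => N / q)
    (fun q hq => (hall q hq).1)
    (fun q hq => ((Nat.div_lt_iff_lt_mul (hall q hq).1.pos).2 (by
      rw [mul_comm]; exact (hall q hq).2)).le)
    (fun q hq => by
      have h1 := (hall q hq).2
      by_contra hcon
      push Not at hcon
      have := Nat.mul_le_mul_right K hcon
      nlinarith)
    (fun q _ => Nat.mul_div_le N q)
  rw [Finset.sum_biUnion hdisj] at hmain
  refine le_trans ?_ hmain
  have hterm : ∀ i ∈ Finset.Ico s (s ^ 2),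
      (c * (1 / 4) ^ k / (20 * Real.log 4)) * ((N : ℝ) / Real.log N) * egP k L * (1 / (i : ℝ)) ≤
        ∑ q ∈ Qi i, Real.log (egyptianFractions (N / q)).card := by
    intro i hi
    have hi' := Finset.mem_Ico.1 hi
    have hi0 : (0 : ℝ) < i := by exact_mod_cast (by omega : 0 < i)
    have h4i : (0 : ℝ) < (4 : ℝ) ^ i := by positivity
    have hiM : n0 ≤ 4 ^ i := (hs.trans hi'.1).trans (Nat.lt_pow_self (by norm_num)).le
    have hB : c * ((4 : ℝ) ^ i / (i * Real.log 4)) * ((1 / 4 : ℝ) ^ k * egP k L) ≤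
        Real.log (egyptianFractions (4 ^ i)).card := by
      refine le_trans ?_ (hind (4 ^ i) hiM)
      have hcast : ((4 ^ i : ℕ) : ℝ) = (4 : ℝ) ^ i := by push_cast; rfl
      rw [hcast, Real.log_pow]
      gcongr
      apply hPq
      refine hL.trans ?_
      apply Real.log_le_log
      · exact_mod_cast (by omega : 0 < s)
      · have : (s : ℝ) ≤ i := by exact_mod_cast hi'.1
        nlinarith
    have h4K : 4 ^ i * 4 ≤ K := by
      have := hpow i hi
      rwa [pow_succ] at this
    have hn0 : K ≤ N / 4 ^ i := by
      rw [Nat.le_div_iff_mul_le (by positivity)]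
      refine le_trans ?_ hKKN
      gcongr; omega
    have hcard : (1 / 20 : ℝ) * N / (4 ^ i * Real.log N) ≤ ((Qi i).card : ℝ) := by
      refine le_trans ?_ (hprime (N / 4 ^ i) (by omega))
      have hn1 : 4 ≤ N / 4 ^ i := by
        have : 0 < 4 ^ i := by positivity
        omega
      have hnR : (4 : ℝ) ≤ ((N / 4 ^ i : ℕ) : ℝ) := by exact_mod_cast hn1
      have hnN : ((N / 4 ^ i : ℕ) : ℝ) ≤ N := by exact_mod_cast Nat.div_le_self _ _
      have hlt : N < (N / 4 ^ i + 1) * 4 ^ i := (Nat.div_lt_iff_lt_mul (by positivity)).1 (Nat.lt_succ_self _)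
      have hltR : (N : ℝ) < (((N / 4 ^ i : ℕ) : ℝ) + 1) * 4 ^ i := by exact_mod_cast hlt
      have hlogn : 0 < Real.log ((N / 4 ^ i : ℕ) : ℝ) := Real.log_pos (by linarith)
      have hlogle : Real.log ((N / 4 ^ i : ℕ) : ℝ) ≤ Real.log N :=
        Real.log_le_log (by linarith) hnN
      calc (1 / 20 : ℝ) * N / (4 ^ i * Real.log N)
          = ((1 / 20 : ℝ) * N / 4 ^ i) / Real.log N := by rw [div_div]
        _ ≤ ((1 / 10 : ℝ) * ((N / 4 ^ i : ℕ) : ℝ)) / Real.log N := by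
            gcongr
            rw [div_le_iff₀ h4i]
            nlinarith
        _ ≤ _ := by gcongr
    calc (c * (1 / 4) ^ k / (20 * Real.log 4)) * ((N : ℝ) / Real.log N) * egP k L * (1 / (i : ℝ))
        = ((1 / 20 : ℝ) * N / (4 ^ i * Real.log N)) *
          (c * ((4 : ℝ) ^ i / (i * Real.log 4)) * ((1 / 4 : ℝ) ^ k * egP k L)) := by
          field_simp
      _ ≤ ((Qi i).card : ℝ) * Real.log (egyptianFractions (4 ^ i)).card := by
          gcongr
      _ ≤ ∑ q ∈ Qi i, Real.log (egyptianFractions (N / q)).card := by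
          rw [← nsmul_eq_mul]
          apply Finset.card_nsmul_le_sum
          intro q hq
          apply egy_log_mono
          have h := hQi i q hq
          rw [Nat.le_div_iff_mul_le h.2.2.pos, mul_comm]
          exact h.2.1
  refine le_trans ?_ (Finset.sum_le_sum hterm)
  rw [← Finset.mul_sum]
  have hh := egy_harm s (s ^ 2) (by omega) (by nlinarith)
  rw [Nat.cast_pow, Real.log_pow] at hh
  have hsum : L / 4 ≤ ∑ i ∈ Finset.Ico s (s ^ 2), (1 : ℝ) / i := by
    push_cast at hh
    linarith
  calc (c * (1 / 4) ^ k / (80 * Real.log 4)) * ((N : ℝ) / Real.log N) * (L * egP k L)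
      = (c * (1 / 4) ^ k / (20 * Real.log 4)) * ((N : ℝ) / Real.log N) * egP k L * (L / 4) := by
        field_simp; ring
    _ ≤ _ := by gcongr

open Filter in
lemma egy_loglog_tendsto : Tendsto (fun N : ℕ => Real.log (Real.log (N : ℝ))) atTop atTop :=
  Real.tendsto_log_atTop.comp (Real.tendsto_log_atTop.comp tendsto_natCast_atTop_atTop)

open Filter in
lemma egy_base : ∃ c : ℝ, 0 < c ∧ ∀ᶠ N : ℕ in atTop,
    c * ((N : ℝ) / Real.log N) * egP 0 (Real.log (Real.log N)) ≤
      Real.log (egyptianFractions N).card := by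
  refine ⟨1 / 10 * Real.log 2, by have := Real.log_pos one_lt_two; positivity, ?_⟩
  filter_upwards [egy_primes] with N hN
  have h := egy_key_log N 1 ((Finset.Ioc (N / 4) N).filter Nat.Prime) (fun _ => 1)
    (fun q hq => (Finset.mem_filter.1 hq).2) (fun _ _ => le_rfl)
    (fun q hq => by simpa using (Finset.mem_filter.1 hq).2.one_lt)
    (fun q hq => by simpa using (Finset.mem_Ioc.1 (Finset.mem_filter.1 hq).1).2)
  have h2 : Real.log 2 ≤ Real.log (egyptianFractions 1).card := by
    apply Real.log_le_log (by norm_num)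
    have : 2 ≤ (egyptianFractions 1).card := by
      have hsub : ({0, 1} : Finset ℚ) ⊆ egyptianFractions 1 := by
        intro x hx
        simp only [Finset.mem_insert, Finset.mem_singleton] at hx
        rw [egy_mem]
        rcases hx with rfl | rfl
        · exact ⟨∅, by simp, by simp⟩
        · exact ⟨{1}, by simp, by simp⟩
      exact (Finset.card_le_card hsub)
    exact_mod_cast this
  refine le_trans ?_ h
  rw [Finset.sum_const, nsmul_eq_mul]
  have hl := Real.log_pos one_lt_two
  calc 1 / 10 * Real.log 2 * ((N : ℝ) / Real.log N) * egP 0 (Real.log (Real.log N))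
      = ((1 / 10 : ℝ) * N / Real.log N) * Real.log 2 := by simp [egP]; ring
    _ ≤ _ := by gcongr

lemma egy_size (N s : ℕ) (t : ℝ) (ht : 6 ≤ t) (hN : Real.exp (Real.exp (t ^ 4)) ≤ N)
    (hs : (s : ℝ) ≤ t + 1) (hs2 : 2 ≤ s) :
    4 ^ (s ^ 2) * (4 ^ (s ^ 2) * (4 ^ (s ^ 2)).factorial) ≤ N := by
  set K : ℕ := 4 ^ (s ^ 2) with hK
  have hK1 : 1 ≤ K := Nat.one_le_pow _ _ (by norm_num)
  have hKR : (1 : ℝ) ≤ K := by exact_mod_cast hK1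
  have h4 : Real.log 4 ≤ 2 := by
    rw [show (4 : ℝ) = 2 ^ 2 by norm_num, Real.log_pow]
    have := Real.log_two_lt_d9
    norm_num at this ⊢; linarith
  have hlogK : Real.log K ≤ t ^ 4 / 4 := by
    have h1 : Real.log K = (s : ℝ) ^ 2 * Real.log 4 := by
      rw [hK]; push_cast; rw [Real.log_pow]; push_cast; rfl
    rw [h1]
    have h2 : (s : ℝ) ^ 2 ≤ (2 * t) ^ 2 := by
      apply pow_le_pow_left₀ (by positivity)
      linarith
    have h3 : (s : ℝ) ^ 2 * Real.log 4 ≤ (2 * t) ^ 2 * 2 := by gcongr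
    have h5 : 36 ≤ t ^ 2 := by nlinarith
    nlinarith
  have hKexp : (K : ℝ) ≤ Real.exp (t ^ 4 / 4) := by
    rwa [← Real.log_le_iff_le_exp (by linarith)]
  have h3K : 3 * (K : ℝ) ^ 2 ≤ Real.exp (t ^ 4) := by
    have e1 : Real.exp (t ^ 4) = (Real.exp (t ^ 4 / 4)) ^ 4 := by
      rw [← Real.exp_nat_mul]; congr 1; push_cast; ring
    have e2 : 3 ≤ Real.exp (t ^ 4 / 4) := by
      have := Real.add_one_le_exp (t ^ 4 / 4)
      have h5 : 36 ≤ t ^ 2 := by nlinarith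
      have : 36 * 36 ≤ t ^ 4 := by nlinarith
      linarith
    rw [e1]
    have h6 : (K : ℝ) ^ 2 ≤ Real.exp (t ^ 4 / 4) ^ 2 := pow_le_pow_left₀ (by linarith) hKexp 2
    have h7 : 3 ≤ Real.exp (t ^ 4 / 4) ^ 2 := by nlinarith
    nlinarith [sq_nonneg (Real.exp (t ^ 4 / 4))]
  have hfact : K * (K * K.factorial) ≤ K ^ (K + 2) := by
    have : K.factorial ≤ K ^ K := Nat.factorial_le_pow K
    calc K * (K * K.factorial) ≤ K * (K * K ^ K) := by gcongr
      _ = K ^ (K + 2) := by ring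
  have hfin : ((K ^ (K + 2) : ℕ) : ℝ) ≤ N := by
    refine le_trans ?_ hN
    rw [← Real.log_le_iff_le_exp (by positivity)]
    push_cast
    rw [Real.log_pow]
    have := Real.log_le_sub_one_of_pos (show (0 : ℝ) < K by linarith)
    have h0 : 0 ≤ Real.log K := Real.log_nonneg hKR
    push_cast
    nlinarith
  exact hfact.trans (by exact_mod_cast hfin)

open Filter in
lemma egy_step (k : ℕ) (H : ∃ c : ℝ, 0 < c ∧ ∀ᶠ N : ℕ in atTop,
    c * ((N : ℝ) / Real.log N) * egP k (Real.log (Real.log N)) ≤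
      Real.log (egyptianFractions N).card) :
    ∃ c : ℝ, 0 < c ∧ ∀ᶠ N : ℕ in atTop,
      c * ((N : ℝ) / Real.log N) * egP (k + 1) (Real.log (Real.log N)) ≤
        Real.log (egyptianFractions N).card := by
  obtain ⟨c, hc, H⟩ := H
  obtain ⟨n0, hn0⟩ := eventually_atTop.1 (H.and egy_primes)
  have hl4 : 0 < Real.log 4 := Real.log_pos (by norm_num)
  refine ⟨c * (1 / 4) ^ k / (80 * Real.log 4), by positivity, ?_⟩
  have tu := egy_loglog_tendsto
  have tt : Tendsto (fun N : ℕ => (Real.log (Real.log (N : ℝ))) ^ (1 / 4 : ℝ)) atTop atTop :=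
    (tendsto_rpow_atTop (by norm_num)).comp tu
  have tL := Real.tendsto_log_atTop.comp tu
  filter_upwards [tt.eventually_ge_atTop (max (n0 : ℝ) 6), tu.eventually_gt_atTop 0,
    tL.eventually (egP_pos k), tL.eventually (egP_quarter k),
    (Real.tendsto_log_atTop.comp (tendsto_natCast_atTop_atTop (R := ℝ))).eventually_gt_atTop 0,
    eventually_gt_atTop 0]
    with N ht hu hP hPq hlog hNpos
  simp only [Function.comp] at hP hPq hlog
  set u := Real.log (Real.log (N : ℝ)) with hudef
  set t := u ^ (1 / 4 : ℝ) with htdef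
  have ht6 : 6 ≤ t := (le_max_right _ _).trans ht
  have htn : (n0 : ℝ) ≤ t := (le_max_left _ _).trans ht
  have ht4 : t ^ 4 = u := by
    rw [htdef, ← Real.rpow_natCast, ← Real.rpow_mul hu.le]; norm_num
  have hts : t ≤ (⌈t⌉₊ : ℝ) := Nat.le_ceil t
  have hs6 : (6 : ℝ) ≤ (⌈t⌉₊ : ℝ) := ht6.trans hts
  have hs6' : 6 ≤ ⌈t⌉₊ := by exact_mod_cast hs6
  rw [egP_succ]
  apply egy_step_fixed k n0 N ⌈t⌉₊ c (Real.log u) hc (fun n hn => (hn0 n hn).2)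
    (fun n hn => (hn0 n hn).1) (by exact_mod_cast htn.trans hts) (by omega) _ hP hPq
  · apply egy_size N ⌈t⌉₊ t ht6 _ (Nat.ceil_lt_add_one (by linarith)).le (by omega)
    rw [ht4, hudef, Real.exp_log hlog, Real.exp_log (by exact_mod_cast hNpos)]
  · have : Real.log t = Real.log u / 4 := by
      rw [htdef, Real.log_rpow hu]; ring
    rw [← this]
    exact Real.log_le_log (by linarith) hts

open Filter in
lemma egy_all (k : ℕ) : ∃ c : ℝ, 0 < c ∧ ∀ᶠ N : ℕ in atTop,
    c * ((N : ℝ) / Real.log N) * egP k (Real.log (Real.log N)) ≤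
      Real.log (egyptianFractions N).card := by
  induction k with
  | zero => exact egy_base
  | succ k ih => exact egy_step k ih

lemma egP_eq (m : ℕ) (x : ℝ) :
    ∏ j ∈ Finset.Icc 3 (m + 2), Real.log^[j] x = egP m (Real.log (Real.log x)) := by
  induction m with
  | zero => simp [egP]
  | succ m ih =>
    rw [show m + 1 + 2 = (m + 2) + 1 by ring, Finset.prod_Icc_succ_top (by omega), ih, egP, egP,
      Finset.prod_range_succ]
    rfl

theorem egyptian_lower_bound (k : ℕ) (hk : 3 ≤ k) :
    ∃ N₀ : ℕ, ∀ N : ℕ, N₀ ≤ N →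
      Real.log (egyptianFractions N).card >
        ((N : ℝ) / Real.log N) * ∏ j ∈ Finset.Icc 3 k, Real.log^[j] (N : ℝ) := by
  obtain ⟨m, rfl⟩ : ∃ m, k = m + 2 := ⟨k - 2, by omega⟩
  obtain ⟨c, hc, H⟩ := egy_all (m + 1)
  apply Filter.eventually_atTop.1
  have tu := egy_loglog_tendsto
  filter_upwards [H, tu.eventually (egP_pos m),
    ((egy_iter_tendsto (m + 1)).comp tu).eventually_gt_atTop (1 / c),
    Filter.eventually_gt_atTop 1] with N hN hP hlog hN1
  simp only [Function.comp] at hlog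
  rw [egP_eq]
  refine lt_of_lt_of_le ?_ hN
  have hNR : (1 : ℝ) < N := by exact_mod_cast hN1
  have hlN : 0 < Real.log N := Real.log_pos hNR
  have hpos : 0 < (N : ℝ) / Real.log N * egP m (Real.log (Real.log N)) := by positivity
  have he : egP (m + 1) (Real.log (Real.log N)) =
      egP m (Real.log (Real.log N)) * Real.log^[m + 1] (Real.log (Real.log N)) := by
    unfold egP; rw [Finset.prod_range_succ]
  rw [he]
  rw [div_lt_iff₀ hc] at hlog
  nlinarith
end

section
/- Let m be a positive integer with m ∈ 𝒰, let g_m := d_m · ∑_{j=1}^{m} 1/j where d_m := lcm{1,…,m}, and let p be a prime with p > g_m. Then mp ∈ 𝒰. -/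
open Finset

/-- `𝒰` is the set of positive integers `N` such that no signed subsum
`∑_{n=1}^{N-1} w_n/n` with `w_n ∈ {-1,0,1}` equals `1/N`. -/
def goodSet : Set ℕ :=
  {N : ℕ | 1 ≤ N ∧ ∀ w : ℕ → ℚ,
    (∀ n ∈ Finset.Icc 1 (N - 1), w n ∈ ({-1, 0, 1} : Set ℚ)) →
    ∑ n ∈ Finset.Icc 1 (N - 1), w n / (n : ℚ) ≠ 1 / (N : ℚ)}

lemma aux_sum_integral (p : ℕ) (hp : p.Prime) (v : ℕ → ℤ) (T : Finset ℕ)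
    (hT : ∀ n ∈ T, ¬ p ∣ n) :
    ∃ a b : ℤ, ¬ (p : ℤ) ∣ b ∧ (b : ℚ) * ∑ n ∈ T, (v n : ℚ) / (n : ℚ) = a := by
  have hpi : Prime (p : ℤ) := Nat.prime_iff_prime_int.mp hp
  induction T using Finset.induction_on with
  | empty => exact ⟨0, 1, fun h => hpi.not_isUnit (isUnit_of_dvd_one h), by simp⟩
  | insert x T hx ih =>
    obtain ⟨a, b, hb, hab⟩ := ih (fun n hn => hT n (Finset.mem_insert_of_mem hn))
    have hxp := hT x (Finset.mem_insert_self x T)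
    have hx0 : (x : ℚ) ≠ 0 := by
      intro h
      apply hxp
      have : x = 0 := by exact_mod_cast h
      simp [this]
    refine ⟨b * v x + x * a, x * b, ?_, ?_⟩
    · intro h
      rcases hpi.dvd_or_dvd h with h | h
      · exact hxp (by exact_mod_cast h)
      · exact hb h
    · rw [Finset.sum_insert hx]
      push_cast
      rw [← hab]
      field_simp

lemma aux_bounded (m p : ℕ) (u : ℕ → ℤ) (hu : ∀ j, |u j| ≤ 1)
    (hpg : (((Finset.Icc 1 m).lcm id : ℕ) : ℚ) * ∑ j ∈ Finset.Icc 1 m, (1 : ℚ) / (j : ℚ)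
      < (p : ℚ)) :
    ∃ A : ℤ, (((Finset.Icc 1 m).lcm id : ℕ) : ℚ) * ∑ j ∈ Finset.Icc 1 m, (u j : ℚ) / (j : ℚ) = A
      ∧ |A| < p := by
  set d := (Finset.Icc 1 m).lcm id with hd
  have key : (d : ℚ) * ∑ j ∈ Finset.Icc 1 m, (u j : ℚ) / (j : ℚ)
      = ((∑ j ∈ Finset.Icc 1 m, u j * ((d / j : ℕ) : ℤ) : ℤ) : ℚ) := by
    rw [Finset.mul_sum, Int.cast_sum]
    refine Finset.sum_congr rfl fun j hj => ?_
    have hjd : j ∣ d := Finset.dvd_lcm (f := id) hj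
    have hj0 : (j : ℚ) ≠ 0 := by
      have := (Finset.mem_Icc.mp hj).1
      positivity
    obtain ⟨k, hk⟩ := hjd
    have hjpos : 0 < j := (Finset.mem_Icc.mp hj).1
    have hdk : d / j = k := by rw [hk, Nat.mul_div_cancel_left _ hjpos]
    rw [hdk, hk]
    push_cast
    field_simp
  refine ⟨_, key, ?_⟩
  have : |(d : ℚ) * ∑ j ∈ Finset.Icc 1 m, (u j : ℚ) / (j : ℚ)| < p := by
    refine lt_of_le_of_lt ?_ hpg
    rw [abs_mul, abs_of_nonneg (by positivity : (0 : ℚ) ≤ d)]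
    refine mul_le_mul_of_nonneg_left ?_ (by positivity)
    refine (Finset.abs_sum_le_sum_abs _ _).trans (Finset.sum_le_sum fun j _ => ?_)
    rw [abs_div, abs_of_nonneg (by positivity : (0 : ℚ) ≤ j)]
    have : |(u j : ℚ)| ≤ 1 := by exact_mod_cast hu j
    gcongr
  rw [key] at this
  exact_mod_cast this

theorem mul_prime_mem_goodSet_of_gt_g
    (m : ℕ) (hm : 0 < m) (hmU : m ∈ goodSet)
    (p : ℕ) (hp : p.Prime)
    (hpg : (((Finset.Icc 1 m).lcm id : ℕ) : ℚ) * ∑ j ∈ Finset.Icc 1 m, (1 : ℚ) / (j : ℚ)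
      < (p : ℚ)) :
    m * p ∈ goodSet := by
  have hp0 : 0 < p := hp.pos
  have hpq : (p : ℚ) ≠ 0 := by positivity
  have hmq : (m : ℚ) ≠ 0 := by positivity
  refine ⟨Nat.mul_pos hm hp0, ?_⟩
  intro w hw hsum
  have hex : ∀ n, ∃ z : ℤ, |z| ≤ 1 ∧ (n ∈ Finset.Icc 1 (m * p - 1) → w n = z) := by
    intro n
    by_cases hn : n ∈ Finset.Icc 1 (m * p - 1)
    · rcases hw n hn with h | h | h
      · exact ⟨-1, by simp, fun _ => by simp [h]⟩
      · exact ⟨0, by simp, fun _ => by simp [h]⟩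
      · exact ⟨1, by simp, fun _ => by simpa using h⟩
    · exact ⟨0, by simp, fun h => absurd h hn⟩
  choose v hv1 hv using hex
  have hmem : ∀ j ∈ Finset.Icc 1 (m - 1), p * j ∈ Finset.Icc 1 (m * p - 1) := by
    intro j hj
    rw [Finset.mem_Icc] at hj ⊢
    have h1 : 0 < p * j := Nat.mul_pos hp0 (by omega)
    have h2 : p * j < p * m := Nat.mul_lt_mul_of_pos_left (by omega) hp0
    rw [mul_comm m p]
    omega
  have hmult : ∑ n ∈ (Finset.Icc 1 (m * p - 1)).filter (fun n => p ∣ n), (v n : ℚ) / (n : ℚ)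
      = ∑ j ∈ Finset.Icc 1 (m - 1), (v (p * j) : ℚ) / ((p * j : ℕ) : ℚ) := by
    symm
    refine Finset.sum_bij (fun j _ => p * j) ?_ ?_ ?_ ?_
    · intro j hj
      exact Finset.mem_filter.mpr ⟨hmem j hj, dvd_mul_right _ _⟩
    · intro a _ b _ h
      exact Nat.eq_of_mul_eq_mul_left hp0 h
    · intro n hn
      obtain ⟨hn1, j, rfl⟩ := Finset.mem_filter.mp hn
      refine ⟨j, ?_, rfl⟩
      rw [Finset.mem_Icc] at hn1 ⊢
      have h1 : 0 < j := Nat.pos_of_ne_zero (by rintro rfl; simp at hn1)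
      have h2 : j < m := by
        refine Nat.lt_of_mul_lt_mul_left (a := p) ?_
        rw [mul_comm p m]
        omega
      omega
    · intro j _
      rfl
  have hwv : ∑ n ∈ Finset.Icc 1 (m * p - 1), w n / (n : ℚ)
      = ∑ n ∈ Finset.Icc 1 (m * p - 1), (v n : ℚ) / (n : ℚ) :=
    Finset.sum_congr rfl (fun n hn => by rw [hv n hn])
  rw [hwv, ← Finset.sum_filter_add_sum_filter_not _ (fun n => p ∣ n), hmult] at hsum
  obtain ⟨a, b, hb, hab⟩ := aux_sum_integral p hp v
    ((Finset.Icc 1 (m * p - 1)).filter (fun n => ¬ p ∣ n))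
    (fun n hn => (Finset.mem_filter.mp hn).2)
  let u : ℕ → ℤ := fun j => if j = m then -1 else v (p * j)
  have hu : ∀ j, |u j| ≤ 1 := by
    intro j
    by_cases h : j = m
    · simp [u, h]
    · simpa [u, h] using hv1 (p * j)
  obtain ⟨A, hA, hAp⟩ := aux_bounded m p u hu hpg
  have hS : ∑ j ∈ Finset.Icc 1 m, (u j : ℚ) / (j : ℚ)
      = ∑ j ∈ Finset.Icc 1 (m - 1), (v (p * j) : ℚ) / (j : ℚ) - 1 / m := by
    obtain ⟨k, rfl⟩ : ∃ k, m = k + 1 := ⟨m - 1, by omega⟩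
    rw [Finset.sum_Icc_succ_top (by omega), Nat.add_sub_cancel, sub_eq_add_neg]
    congr 1
    · refine Finset.sum_congr rfl fun j hj => ?_
      have : j ≠ k + 1 := by
        have := (Finset.mem_Icc.mp hj).2
        omega
      simp [u, this]
    · simp [u, neg_div]
  have hpS : ∑ j ∈ Finset.Icc 1 (m - 1), (v (p * j) : ℚ) / ((p * j : ℕ) : ℚ)
      = (∑ j ∈ Finset.Icc 1 (m - 1), (v (p * j) : ℚ) / (j : ℚ)) / p := by
    rw [Finset.sum_div]
    refine Finset.sum_congr rfl fun j _ => ?_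
    push_cast
    rw [div_div, mul_comm (p : ℚ)]
  rw [hpS] at hsum
  set d := (Finset.Icc 1 m).lcm id with hd
  set X := ∑ j ∈ Finset.Icc 1 (m - 1), (v (p * j) : ℚ) / (j : ℚ) with hX
  set Y := ∑ n ∈ (Finset.Icc 1 (m * p - 1)).filter (fun n => ¬ p ∣ n), (v n : ℚ) / (n : ℚ) with hY
  rw [hS] at hA
  have hXY : X - 1 / m = - (p * Y) := by
    have h3 : X / p + Y = 1 / m / p := by
      rw [hsum]; push_cast; rw [div_div]
    field_simp at h3 ⊢
    linarith
  have hdvd : b * A = p * (-(d * a)) := by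
    have : (b : ℚ) * A = p * (-(d * a)) := by
      rw [← hA, hXY, ← hab]; ring
    exact_mod_cast this
  have hpi : Prime (p : ℤ) := Nat.prime_iff_prime_int.mp hp
  have hA0 : A = 0 := by
    rcases hpi.dvd_or_dvd (Dvd.intro _ hdvd.symm) with h | h
    · exact absurd h hb
    · exact Int.eq_zero_of_abs_lt_dvd h hAp
  have hd0 : (d : ℚ) ≠ 0 := by
    have : d ≠ 0 := by
      rw [hd, Ne, Finset.lcm_eq_zero_iff]
      simp
    exact_mod_cast this
  rw [hA0] at hA
  have hX0 : X = 1 / m := by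
    have : X - 1 / m = 0 := by simpa [hd0] using hA
    linarith
  refine hmU.2 (fun j => (v (p * j) : ℚ)) ?_ hX0
  intro j hj
  have := hw _ (hmem j hj)
  rwa [hv _ (hmem j hj)] at this
end

section
/- For every positive integer m, one has g_m < 3^m, where d_m := lcm{1,…,m} and g_m := d_m · ∑_{j=1}^{m} 1/j. -/
open Finset

/-- evaluate `x` first, then apply `f` -/
def forceNat (x : ℕ) (f : ℕ → Bool) : Bool := Nat.rec (f 0) (fun k _ => f (k + 1)) x

theorem forceNat_eq (x : ℕ) (f : ℕ → Bool) : forceNat x f = f x := by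
  cases x <;> rfl

def chk (k : ℕ) : ℕ → ℕ → ℕ → ℕ → Bool :=
  Nat.rec (fun _ _ _ _ => true) (fun _ ih m d g t =>
    forceNat (m + 1) fun m' => forceNat (d / Nat.gcd d m' * m') fun d' =>
    forceNat (g * (d' / d) + d' / m') fun g' => forceNat (3 * t) fun t' =>
    cond (Nat.ble (g' + 1) t') (ih m' d' g' t') false) k

theorem chk_succ (k m d g t : ℕ) : chk (k+1) m d g t = true ↔
    g * ((d / Nat.gcd d (m+1) * (m+1)) / d) + (d / Nat.gcd d (m+1) * (m+1)) / (m+1) < 3 * t ∧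
    chk k (m+1) (d / Nat.gcd d (m+1) * (m+1))
     (g * ((d / Nat.gcd d (m+1) * (m+1)) / d) + (d / Nat.gcd d (m+1) * (m+1)) / (m+1)) (3*t) = true := by
  change (forceNat (m + 1) fun m' => forceNat (d / Nat.gcd d m' * m') fun d' =>
    forceNat (g * (d' / d) + d' / m') fun g' => forceNat (3 * t) fun t' =>
    cond (Nat.ble (g' + 1) t') (chk k m' d' g' t') false) = true ↔ _
  simp only [forceNat_eq]
  rw [Nat.lt_iff_add_one_le, ← Nat.ble_eq]
  cases Nat.ble _ (3 * t) <;> simp only [cond_true, cond_false, true_and, false_and, Bool.false_eq_true]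

abbrev dd (m : ℕ) : ℕ := (Icc 1 m).lcm id
abbrev HH (m : ℕ) : ℚ := ∑ j ∈ Finset.Icc 1 m, (1 : ℚ) / (j : ℚ)

theorem dd_succ (m : ℕ) : dd (m+1) = Nat.lcm (dd m) (m+1) := by
  unfold dd
  rw [← Finset.insert_Icc_right_eq_Icc_add_one (by omega), Finset.lcm_insert]
  exact Nat.lcm_comm _ _

theorem dd_pos (m : ℕ) : 0 < dd m := _root_.Nat.pos_of_ne_zero (by simp [dd])

theorem HH_succ (m : ℕ) : HH (m+1) = HH m + 1 / ((m+1 : ℕ) : ℚ) := by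
  unfold HH
  rw [Finset.sum_Icc_succ_top (by omega)]

theorem chk_sound (k : ℕ) : ∀ m d g t : ℕ, chk k m d g t = true → d = dd m →
    (g : ℚ) = dd m * HH m → t = 3 ^ m → ∀ j, m < j → j ≤ m + k → (dd j : ℚ) * HH j < 3 ^ j := by
  induction k with
  | zero => intros; omega
  | succ k ih =>
    intro m d g t h hd hg ht j hj hj'
    rw [chk_succ] at h
    have e : d / Nat.gcd d (m+1) * (m+1) = dd (m+1) := by
      rw [dd_succ, ← hd, Nat.lcm, Nat.div_mul_right_comm (Nat.gcd_dvd_left _ _)]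
    rw [e] at h
    have h1 : d ∣ dd (m+1) := by rw [dd_succ, hd]; exact Nat.dvd_lcm_left _ _
    have h2 : (m+1) ∣ dd (m+1) := by rw [dd_succ]; exact Nat.dvd_lcm_right _ _
    have hd0 : (d : ℚ) ≠ 0 := by
      have := dd_pos m
      rw [← hd] at this
      exact_mod_cast this.ne'
    have hg' : ((g * (dd (m+1) / d) + dd (m+1) / (m+1) : ℕ) : ℚ) = dd (m+1) * HH (m+1) := by
      rw [HH_succ, Nat.cast_add, Nat.cast_mul, Nat.cast_div h1 hd0,
        Nat.cast_div h2 (by positivity), hg, ← hd]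
      field_simp
    have ht' : 3 * t = 3 ^ (m+1) := by rw [ht]; ring
    rcases Nat.lt_or_ge (m+1) j with hlt | hge
    · exact ih (m+1) _ _ _ h.2 rfl hg' ht' j hlt (by omega)
    · obtain rfl : j = m + 1 := by omega
      rw [← hg']
      have := h.1
      rw [ht'] at this
      exact_mod_cast this

theorem chk_run : chk 3000 0 1 0 1 = true := by decide +kernel

theorem small (m : ℕ) (hm : 0 < m) (h : m ≤ 3000) : (dd m : ℚ) * HH m < 3 ^ m :=
  chk_sound 3000 0 1 0 1 chk_run (by simp [dd]) (by simp [HH]) (by simp) m hm (by omega)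


theorem dd_factorization (n : ℕ) {p : ℕ} (hp : p.Prime) : (dd n).factorization p = Nat.log p n :=
  Nat.factorization_lcmUpto n hp

theorem log_eq_sum (p n b : ℕ) (hp : p.Prime) (hb : Nat.log p n < b) :
    Nat.log p n = ∑ i ∈ Ico 1 b, if 1 ≤ n / p ^ i then 1 else 0 := by
  rcases Nat.eq_zero_or_pos n with rfl | hn
  · simp
  rw [Finset.sum_boole]
  have : {i ∈ Ico 1 b | 1 ≤ n / p ^ i} = Ico 1 (Nat.log p n + 1) := by
    ext i
    simp only [mem_filter, mem_Ico]
    rw [Nat.le_div_iff_mul_le (pow_pos hp.pos _), one_mul, ← Nat.le_log_iff_pow_le hp.one_lt hn.ne']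
    omega
  rw [this]
  simp

theorem key_dvd (n : ℕ) :
    dd n * ((n/2).factorial * (n/3).factorial * (n/7).factorial * (n/43).factorial *
      (n/1806).factorial) ∣ n.factorial * dd (n/1806) := by
  have h1 := (dd_pos n).ne'
  have h2 := (dd_pos (n/1806)).ne'
  have f := Nat.factorial_ne_zero
  have hA : (n/2).factorial * (n/3).factorial * (n/7).factorial * (n/43).factorial *
      (n/1806).factorial ≠ 0 := by simp [f]
  rw [← Nat.factorization_le_iff_dvd (mul_ne_zero h1 hA) (mul_ne_zero (f _) h2),
    Nat.factorization_mul h1 hA, Nat.factorization_mul (f _) h2]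
  repeat rw [Nat.factorization_mul (by simp [f]) (f _)]
  intro p
  by_cases hp : p.Prime
  swap
  · simp [Nat.factorization_eq_zero_of_not_prime _ hp]
  simp only [Finsupp.add_apply]
  rw [dd_factorization _ hp, dd_factorization _ hp]
  have hb : ∀ a, Nat.log p (n/a) < Nat.log p n + 1 := fun a =>
    Nat.lt_succ_of_le (Nat.log_mono_right (Nat.div_le_self _ _))
  have hb1 : Nat.log p n < Nat.log p n + 1 := Nat.lt_succ_self _
  rw [Nat.factorization_factorial hp (hb 2), Nat.factorization_factorial hp (hb 3),
    Nat.factorization_factorial hp (hb 7), Nat.factorization_factorial hp (hb 43),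
    Nat.factorization_factorial hp (hb 1806), Nat.factorization_factorial hp hb1]
  generalize Nat.log p n + 1 = b at *
  rw [log_eq_sum p n b hp hb1, log_eq_sum p (n/1806) b hp (hb _)]
  simp only [← Finset.sum_add_distrib]
  apply Finset.sum_le_sum
  intro i _
  have hc : ∀ a, n / a / p ^ i = n / p ^ i / a := fun a => by
    rw [Nat.div_div_eq_div_mul, Nat.div_div_eq_div_mul, mul_comm]
  simp only [hc]
  generalize n / p ^ i = x
  split_ifs <;> omega

theorem multi_le (a b c d e : ℕ) :
    ((a+b+c+d+e).factorial : ℝ) ≤ (a.factorial * b.factorial * c.factorial * d.factorial *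
      e.factorial) * (2^a * 3^b * 7^c * 43^d * 1806^e) := by
  have h := Finset.sum_pow_eq_sum_piAntidiag (univ : Finset (Fin 5))
    (![1/2, 1/3, 1/7, 1/43, 1/1806] : Fin 5 → ℝ) (a+b+c+d+e)
  have hs := Nat.multinomial_spec (univ : Finset (Fin 5)) ![a,b,c,d,e]
  have hle := Finset.single_le_sum (s := piAntidiag (univ : Finset (Fin 5)) (a+b+c+d+e))
    (f := fun k => (Nat.multinomial univ k : ℝ) *
      ∏ i, (![1/2, 1/3, 1/7, 1/43, 1/1806] : Fin 5 → ℝ) i ^ k i) (by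
      intro k _
      refine mul_nonneg (by positivity) (Finset.prod_nonneg fun i _ => pow_nonneg ?_ _)
      fin_cases i <;> norm_num) (a := ![a,b,c,d,e]) (by
      simp [Fin.sum_univ_five])
  rw [← h] at hle
  simp [Fin.sum_univ_five, Fin.prod_univ_five] at hle hs
  norm_num at hle
  rw [← hs]
  push_cast
  refine mul_le_mul_of_nonneg_left ?_ (by positivity)
  generalize (Nat.multinomial univ ![a,b,c,d,e] : ℝ) = M at *
  have h3 : (0:ℝ) < 2^a * 3^b * 7^c * 43^d * 1806^e := by positivity
  calc M = M * ((1/2)^a * (1/3)^b * (1/7)^c * (1/43)^d * (1/1806)^e) *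
      (2^a * 3^b * 7^c * 43^d * 1806^e) := by
        simp only [one_div, inv_pow]
        field_simp
    _ ≤ 1 * (2^a * 3^b * 7^c * 43^d * 1806^e) := by
        refine mul_le_mul_of_nonneg_right ?_ h3.le
        simpa using hle
    _ = _ := one_mul _

theorem dd_le (n : ℕ) (hn : 0 < n) : (dd n : ℝ) ≤
    n ^ 4 * (2^(n/2) * 3^(n/3) * 7^(n/7) * 43^(n/43) * 1806^(n/1806)) * dd (n/1806) := by
  have h1 := Nat.le_of_dvd (Nat.mul_pos (Nat.factorial_pos _) (dd_pos _)) (key_dvd n)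
  have h2 := multi_le (n/2) (n/3) (n/7) (n/43) (n/1806)
  have h3 : n.factorial ≤ n ^ 4 * (n/2+n/3+n/7+n/43+n/1806).factorial := by
    have hr : n - (n/2+n/3+n/7+n/43+n/1806) ≤ 4 := by omega
    have hr' : n - (n/2+n/3+n/7+n/43+n/1806) ≤ n := Nat.sub_le _ _
    have hN : n/2+n/3+n/7+n/43+n/1806 = n - (n - (n/2+n/3+n/7+n/43+n/1806)) := by omega
    rw [hN]
    generalize n - (n/2+n/3+n/7+n/43+n/1806) = r at *
    rw [← Nat.factorial_mul_descFactorial hr', mul_comm]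
    exact Nat.mul_le_mul_right _ ((Nat.descFactorial_le_pow _ _).trans
      (Nat.pow_le_pow_right hn hr))
  have h1' : (dd n : ℝ) * (((n/2).factorial : ℝ) * (n/3).factorial * (n/7).factorial *
      (n/43).factorial * (n/1806).factorial) ≤ n.factorial * dd (n/1806) := by exact_mod_cast h1
  have h3' : (n.factorial : ℝ) ≤ n ^ 4 * (n/2+n/3+n/7+n/43+n/1806).factorial := by
    exact_mod_cast h3
  have hF : (0:ℝ) < ((n/2).factorial : ℝ) * (n/3).factorial * (n/7).factorial *
      (n/43).factorial * (n/1806).factorial := by positivity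
  generalize ((n/2).factorial : ℝ) * (n/3).factorial * (n/7).factorial *
      (n/43).factorial * (n/1806).factorial = F at *
  refine le_of_mul_le_mul_right (h1'.trans ?_) hF
  calc (n.factorial : ℝ) * dd (n/1806)
      ≤ (n ^ 4 * (F * (2^(n/2) * 3^(n/3) * 7^(n/7) * 43^(n/43) * 1806^(n/1806)))) *
        dd (n/1806) := by
        gcongr
        exact h3'.trans (by gcongr)
    _ = _ := by ring

theorem HH_le (n : ℕ) : HH n ≤ n := by
  unfold HH
  calc _ ≤ ∑ j ∈ Icc 1 n, (1:ℚ) := by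
        apply Finset.sum_le_sum
        intro j hj
        have : (1:ℚ) ≤ j := by exact_mod_cast (Finset.mem_Icc.1 hj).1
        rw [div_le_one (by linarith)]
        exact this
    _ = n := by simp

theorem one_le_HH (n : ℕ) (hn : 0 < n) : 1 ≤ HH n := by
  unfold HH
  have := Finset.single_le_sum (s := Icc 1 n) (f := fun j : ℕ => (1:ℚ) / j)
    (fun i _ => by positivity) (a := 1) (by simp; omega)
  simpa using this

theorem pow_div_le (a n : ℕ) :
    ((n / a : ℕ) : ℝ) * Real.log a ≤ n * (Real.log a / a) := by
  have h : ((n / a : ℕ) : ℝ) ≤ n / a := Nat.cast_div_le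
  have := mul_le_mul_of_nonneg_right h (Real.log_natCast_nonneg a)
  calc _ ≤ _ := this
    _ = _ := by ring

set_option exponentiation.threshold 3000 in
theorem final_ineq (n : ℕ) (hn : 3000 ≤ n) :
    (n:ℝ) ^ 5 * (2^(n/2) * 3^(n/3) * 7^(n/7) * 43^(n/43) * 1806^(n/1806)) * 3^(n/1806) < 3 ^ n := by
  have hn' : (3000:ℝ) ≤ n := by exact_mod_cast hn
  have hn0 : (0:ℝ) < n := by linarith
  rw [← Real.log_lt_log_iff (by positivity) (by positivity)]
  rw [Real.log_mul (by positivity) (by positivity), Real.log_mul (by positivity) (by positivity)]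
  repeat rw [Real.log_mul (by positivity) (by positivity)]
  simp only [Real.log_pow]
  have l2 := pow_div_le 2 n
  have l3 := pow_div_le 3 n
  have l7 := pow_div_le 7 n
  have l43 := pow_div_le 43 n
  have l1806 := pow_div_le 1806 n
  push_cast at l2 l3 l7 l43 l1806
  have l3' : ((n/1806 : ℕ) : ℝ) * Real.log 3 ≤ n * (Real.log 3 / 1806) := by
    have h : ((n / 1806 : ℕ) : ℝ) ≤ n / 1806 := by exact_mod_cast Nat.cast_div_le
    have := mul_le_mul_of_nonneg_right h (Real.log_nonneg (show (1:ℝ) ≤ 3 by norm_num))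
    calc _ ≤ _ := this
      _ = _ := by ring
  have hlog3 : 16 ≤ 15 * Real.log 3 := by
    have : Real.exp 16 ≤ 3 ^ 15 := by
      rw [show (16:ℝ) = (16:ℕ) * 1 by norm_num, Real.exp_nat_mul]
      calc _ ≤ (2.7182818286:ℝ) ^ 16 := by
            gcongr
            exact Real.exp_one_lt_d9.le
        _ ≤ _ := by norm_num
    rw [← Real.le_log_iff_exp_le (by norm_num), Real.log_pow] at this
    exact_mod_cast this
  have hlogn : Real.log n ≤ 7 + n / 2900 := by
    have h8 : (2900:ℝ) ≤ Real.exp 8 := by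
      rw [show (8:ℝ) = (8:ℕ) * 1 by norm_num, Real.exp_nat_mul]
      calc _ ≤ (2.7182818283:ℝ) ^ 8 := by norm_num
        _ ≤ _ := by
            gcongr
            exact Real.exp_one_gt_d9.le
    have := Real.log_le_sub_one_of_pos (show 0 < (n:ℝ) / Real.exp 8 by positivity)
    rw [Real.log_div hn0.ne' (Real.exp_pos _).ne', Real.log_exp] at this
    have h9 : (n:ℝ) / Real.exp 8 ≤ n / 2900 := by gcongr
    linarith
  have hW : 903 * Real.log 2 + 602 * Real.log 3 + 258 * Real.log 7 + 42 * Real.log 43 +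
      Real.log 1806 + 24 * Real.log 3 ≤ 1806 * Real.log 3 := by
    have : (2:ℝ)^903 * 3^602 * 7^258 * 43^42 * 1806 * 3^24 ≤ 3^1806 := by norm_num
    have := Real.log_le_log (by positivity) this
    repeat rw [Real.log_mul (by positivity) (by positivity)] at this
    simp only [Real.log_pow] at this
    exact_mod_cast this
  have hW' := mul_le_mul_of_nonneg_left hW hn0.le
  have h16 := mul_le_mul_of_nonneg_left hlog3 hn0.le
  push_cast
  linarith

theorem main_ind (m : ℕ) : 0 < m → (dd m : ℚ) * HH m < 3 ^ m := by
  induction m using Nat.strong_induction_on with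
  | _ m ih =>
    intro hm
    rcases Nat.lt_or_ge 3000 m with h | h
    swap
    · exact small m hm h
    have hk : 0 < m / 1806 := by omega
    have hi := ih (m/1806) (by omega) hk
    have hd : (dd (m/1806) : ℚ) ≤ 3 ^ (m/1806) :=
      (le_mul_of_one_le_right (by positivity) (one_le_HH _ hk)).trans hi.le
    have hd' : (dd (m/1806) : ℝ) ≤ 3 ^ (m/1806) := by exact_mod_cast hd
    have h1 : (dd m : ℝ) * m < 3 ^ m := by
      refine lt_of_le_of_lt ?_ (final_ineq m h.le)
      calc (dd m : ℝ) * m ≤ (m ^ 4 * (2^(m/2) * 3^(m/3) * 7^(m/7) * 43^(m/43) *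
              1806^(m/1806)) * 3^(m/1806)) * m := by
            refine mul_le_mul_of_nonneg_right ?_ (by positivity)
            exact (dd_le m hm).trans (by gcongr)
        _ = _ := by ring
    have h2 : (dd m : ℚ) * m < 3 ^ m := by exact_mod_cast h1
    exact lt_of_le_of_lt (mul_le_mul_of_nonneg_left (HH_le m) (by positivity)) h2

theorem g_m_lt_three_pow (m : ℕ) (hm : 0 < m) :
    (((Finset.Icc 1 m).lcm id : ℕ) : ℚ) * ∑ j ∈ Finset.Icc 1 m, (1 : ℚ) / (j : ℚ)
      < (3 : ℚ) ^ m := main_ind m hm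
end

section
/- Let m be a positive integer with m ∈ 𝒰 and let p be a prime with p > 3^m. Then mp ∈ 𝒰. -/
open Finset

open ArithmeticFunction in
lemma aux_log_factorial (n N : ℕ) (h : n ≤ N) :
    Real.log (n.factorial : ℝ) = ∑ d ∈ Finset.Ioc 0 N, Λ d * ((n / d : ℕ) : ℝ) := by
  have h1 := sum_Ioc_mul_zeta_eq_sum (R := ℝ) Λ n
  rw [vonMangoldt_mul_zeta] at h1
  have h2 : ∑ x ∈ Finset.Ioc 0 n, ArithmeticFunction.log x = Real.log (n.factorial : ℝ) := by
    clear h1 h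
    induction n with
    | zero => simp
    | succ k ih =>
      rw [← Finset.insert_Ioc_right_eq_Ioc_add_one (by omega), Finset.sum_insert (by simp), ih, Nat.factorial_succ]
      push_cast
      rw [Real.log_mul (by positivity) (by positivity)]
      simp [ArithmeticFunction.log_apply]
  rw [← h2, h1]
  apply Finset.sum_subset
  · intro x hx
    simp at hx ⊢
    omega
  · intro x hx hx'
    simp at hx hx'
    rw [Nat.div_eq_of_lt (by omega)]
    simp

open ArithmeticFunction in
lemma aux_psi_le (n : ℕ) :
    Chebyshev.psi n ≤ Real.log (n.factorial : ℝ) - Real.log ((n / 2).factorial : ℝ)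
      - Real.log ((n / 3).factorial : ℝ) - Real.log ((n / 7).factorial : ℝ)
      - Real.log ((n / 43).factorial : ℝ) - Real.log ((n / 1806).factorial : ℝ)
      + Chebyshev.psi ((n / 1806 : ℕ) : ℝ) := by
  rw [aux_log_factorial n n le_rfl, aux_log_factorial (n / 2) n (Nat.div_le_self _ _),
    aux_log_factorial (n / 3) n (Nat.div_le_self _ _),
    aux_log_factorial (n / 7) n (Nat.div_le_self _ _),
    aux_log_factorial (n / 43) n (Nat.div_le_self _ _),
    aux_log_factorial (n / 1806) n (Nat.div_le_self _ _)]
  have hpsi : Chebyshev.psi ((n / 1806 : ℕ) : ℝ)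
      = ∑ d ∈ Finset.Ioc 0 n, Λ d * (if d ≤ n / 1806 then 1 else 0) := by
    unfold Chebyshev.psi
    rw [Nat.floor_natCast]
    simp only [mul_ite, mul_one, mul_zero]
    rw [← Finset.sum_filter]
    apply Finset.sum_congr _ (fun _ _ => rfl)
    ext x
    have := Nat.div_le_self n 1806
    simp
    omega
  rw [hpsi, ← Finset.sum_sub_distrib, ← Finset.sum_sub_distrib, ← Finset.sum_sub_distrib,
    ← Finset.sum_sub_distrib, ← Finset.sum_sub_distrib, ← Finset.sum_add_distrib]
  unfold Chebyshev.psi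
  rw [Nat.floor_natCast]
  apply Finset.sum_le_sum
  intro d hd
  simp only [Finset.mem_Ioc] at hd
  have key : 1 + n / 2 / d + n / 3 / d + n / 7 / d + n / 43 / d + n / 1806 / d
      ≤ n / d + (if d ≤ n / 1806 then 1 else 0) := by
    rw [Nat.div_right_comm n 2, Nat.div_right_comm n 3, Nat.div_right_comm n 7,
      Nat.div_right_comm n 43, Nat.div_right_comm n 1806]
    have h1 : 1 ≤ n / d := (Nat.one_le_div_iff hd.1).2 hd.2
    split_ifs with h
    · omega
    · have h2 : n / d < 1806 := by
        rw [Nat.div_lt_iff_lt_mul hd.1]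
        have := Nat.div_add_mod n 1806
        have := Nat.mod_lt n (show 0 < 1806 by norm_num)
        omega
      omega
  have key' : (1 : ℝ) + ((n / 2 / d : ℕ) : ℝ) + ((n / 3 / d : ℕ) : ℝ) + ((n / 7 / d : ℕ) : ℝ)
      + ((n / 43 / d : ℕ) : ℝ) + ((n / 1806 / d : ℕ) : ℝ)
      ≤ ((n / d : ℕ) : ℝ) + (if d ≤ n / 1806 then 1 else 0) := by
    exact_mod_cast key
  have hL : (0 : ℝ) ≤ Λ d := vonMangoldt_nonneg
  have := mul_le_mul_of_nonneg_left key' hL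
  linarith

lemma aux_fact_upper (n : ℕ) (hn : 1 ≤ n) :
    Real.log (n.factorial : ℝ) ≤ n * Real.log n - n + Real.log n + 1 := by
  induction n, hn using Nat.le_induction with
  | base => simp
  | succ k hk ih =>
    rw [Nat.factorial_succ]
    push_cast
    rw [Real.log_mul (by positivity) (by positivity)]
    have hk0 : (0 : ℝ) < k := by exact_mod_cast hk
    -- (k+1) (log (k+1) - log k) ≥ 1
    have h1 : Real.log (k / (k + 1)) ≤ k / (k + 1) - 1 :=
      Real.log_le_sub_one_of_pos (by positivity)
    rw [Real.log_div (by positivity) (by positivity)] at h1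
    have h2 : (k : ℝ) / (k + 1) - 1 = - (1 / (k + 1)) := by field_simp; ring
    rw [h2] at h1
    have h3 := mul_le_mul_of_nonneg_left h1 (show (0 : ℝ) ≤ k + 1 by positivity)
    have h4 : ((k : ℝ) + 1) * -(1 / (k + 1)) = -1 := by field_simp
    rw [h4] at h3
    linarith

lemma aux_fact_lower (n a : ℕ) (ha : 1 ≤ a) (hn : a ≤ n) :
    ((n : ℝ) / a - 1) * (Real.log n - Real.log a) - n / a
      ≤ Real.log ((n / a).factorial : ℝ) := by
  have ha0 : (0 : ℝ) < a := by exact_mod_cast ha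
  have hn0 : (0 : ℝ) < n := by exact_mod_cast (lt_of_lt_of_le ha hn)
  have hx : (0 : ℝ) < (n : ℝ) / a := by positivity
  have h := Real.pow_div_factorial_le_exp _ hx.le (n / a)
  have h2 := Real.log_le_log (by positivity) h
  rw [Real.log_exp, Real.log_div (by positivity) (by positivity), Real.log_pow,
    Real.log_div (by positivity) (by positivity)] at h2
  have hlog : 0 ≤ Real.log n - Real.log a := by
    have := Real.log_le_log ha0 (show (a : ℝ) ≤ n by exact_mod_cast hn)
    linarith
  have hk : (n : ℝ) / a - 1 ≤ ((n / a : ℕ) : ℝ) := by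
    have := Nat.lt_div_mul_add (a := n) (b := a) (by omega)
    have h3 : (n : ℝ) < ((n / a : ℕ) : ℝ) * a + a := by exact_mod_cast this
    rw [sub_le_iff_le_add, div_le_iff₀ ha0]
    linarith
  have := mul_le_mul_of_nonneg_right hk hlog
  linarith

lemma aux_log_pow_le (a b k l : ℕ) (ha : 0 < a) (h : a ^ k ≤ b ^ l) :
    (k : ℝ) * Real.log a ≤ l * Real.log b := by
  rw [← Real.log_pow, ← Real.log_pow]
  apply Real.log_le_log (by positivity)
  exact_mod_cast h

lemma aux_large (n : ℕ) (hn : 4096 ≤ n) : Nat.lcmUpto n * n ≤ 3 ^ n := by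
  have hn0 : (0 : ℝ) < n := by exact_mod_cast (by omega : 0 < n)
  have hn1 : (4096 : ℝ) ≤ n := by exact_mod_cast hn
  have h0 := aux_psi_le n
  have hU := aux_fact_upper n (by omega)
  have l2 := aux_fact_lower n 2 (by norm_num) (by omega)
  have l3 := aux_fact_lower n 3 (by norm_num) (by omega)
  have l7 := aux_fact_lower n 7 (by norm_num) (by omega)
  have l43 := aux_fact_lower n 43 (by norm_num) (by omega)
  have l1806 := aux_fact_lower n 1806 (by norm_num) (by omega)
  have hp := Chebyshev.psi_le_const_mul_self (x := ((n / 1806 : ℕ) : ℝ)) (by positivity)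
  have e3 := aux_log_pow_le 2 3 19 12 (by norm_num) (by norm_num)
  have e7 := aux_log_pow_le 7 2 26 73 (by norm_num) (by norm_num)
  have e7' := aux_log_pow_le 2 7 14 5 (by norm_num) (by norm_num)
  have e43 := aux_log_pow_le 43 2 7 38 (by norm_num) (by norm_num)
  have e43' := aux_log_pow_le 2 43 5 1 (by norm_num) (by norm_num)
  have e1806 : Real.log 1806 = Real.log 2 + Real.log 3 + Real.log 7 + Real.log 43 := by
    rw [← Real.log_mul (by norm_num) (by norm_num), ← Real.log_mul (by norm_num) (by norm_num),
      ← Real.log_mul (by norm_num) (by norm_num)]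
    norm_num
  have e4 : Real.log 4 = 2 * Real.log 2 := by
    rw [show (4 : ℝ) = 2 ^ 2 by norm_num, Real.log_pow]; norm_num
  have hlogn : Real.log n ≤ 12 * Real.log 2 + n / 4096 - 1 := by
    have h1 : Real.log (n / 4096) ≤ n / 4096 - 1 := Real.log_le_sub_one_of_pos (by positivity)
    rw [Real.log_div (by positivity) (by norm_num), show (4096 : ℝ) = 2 ^ 12 by norm_num,
      Real.log_pow] at h1
    norm_num at h1 ⊢
    linarith
  have a1 := Real.log_two_gt_d9
  have a2 := Real.log_two_lt_d9
  have hdiv : ((n / 1806 : ℕ) : ℝ) ≤ n / 1806 := by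
    have := @Nat.cast_div_le ℝ _ _ _ n 1806
    exact_mod_cast this
  have hp2 : Chebyshev.psi ((n / 1806 : ℕ) : ℝ) ≤ 5.4 * (n / 1806) := by
    refine hp.trans ?_
    apply mul_le_mul (by rw [e4]; linarith) hdiv (by positivity) (by norm_num)
  push_cast at e3 e7 e7' e43 e43' l2 l3 l7 l43 l1806
  rw [e1806] at l1806
  have p3 := mul_le_mul_of_nonneg_left e3 hn0.le
  have p7 := mul_le_mul_of_nonneg_left e7 hn0.le
  have p43 := mul_le_mul_of_nonneg_left e43 hn0.le
  have pa1 := mul_le_mul_of_nonneg_left a1.le hn0.le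
  have pa2 := mul_le_mul_of_nonneg_left a2.le hn0.le
  have goal1 : Chebyshev.psi n + Real.log n ≤ n * Real.log 3 := by
    ring_nf at *
    linarith
  rw [Chebyshev.psi_eq_log_lcmUpto] at goal1
  have hL : (0 : ℝ) < Nat.lcmUpto n := by exact_mod_cast Nat.lcmUpto_pos n
  rw [← Real.log_mul hL.ne' hn0.ne', ← Real.log_pow, Real.log_le_log_iff (by positivity)
    (by positivity)] at goal1
  exact_mod_cast goal1

lemma aux_lcm_succ (n : ℕ) :
    Nat.lcmUpto (n + 1) = Nat.lcm (Nat.lcmUpto n) (n + 1) := by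
  unfold Nat.lcmUpto
  rw [← Finset.insert_Icc_right_eq_Icc_add_one (by omega), Finset.lcm_insert, Nat.lcm_comm]
  rfl

/-- Identity on predicates, written by cases so that kernel evaluation forces the argument. -/
def auxForce (n : ℕ) (k : ℕ → Bool) : Bool :=
  Nat.casesOn (motive := fun _ => Bool) n (k 0) (fun j => k (j + 1))

lemma auxForce_eq (n : ℕ) (k : ℕ → Bool) : auxForce n k = k n := by
  cases n <;> rfl

/-- Checks `lcm(1..k) * k ≤ 3 ^ k` for `k = n+1, ..., n+fuel`, from `L = lcm(1..n)`, `P = 3^n`. -/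
def auxCheck : ℕ → ℕ → ℕ → ℕ → Bool
  | 0, _, _, _ => true
  | f + 1, n, L, P =>
    auxForce (n + 1) fun n' => auxForce (P * 3) fun P' => auxForce (L * n' / Nat.gcd L n') fun L' =>
      Nat.ble (L' * n') P' && auxCheck f n' L' P'

lemma auxCheck_spec (f : ℕ) : ∀ n, auxCheck f n (Nat.lcmUpto n) (3 ^ n) = true →
    ∀ k, n < k → k ≤ n + f → Nat.lcmUpto k * k ≤ 3 ^ k := by
  induction f with
  | zero => intro n _ k h1 h2; omega
  | succ f ih =>
    intro n h k h1 h2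
    rw [auxCheck, auxForce_eq, auxForce_eq, auxForce_eq, ← Nat.lcm, ← aux_lcm_succ, ← pow_succ,
      Bool.and_eq_true] at h
    rcases Nat.lt_or_ge (n + 1) k with h3 | h3
    · exact ih (n + 1) h.2 k h3 (by omega)
    · obtain rfl : k = n + 1 := by omega
      exact Nat.le_of_ble_eq_true h.1

lemma aux_mid (n : ℕ) (h1 : 43 < n) (h2 : n ≤ 4096) : Nat.lcmUpto n * n ≤ 3 ^ n := by
  have h43 : Nat.lcmUpto 43 = 9419588158802421600 := by decide +kernel
  refine auxCheck_spec 4053 43 ?_ n h1 (by omega)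
  rw [h43]
  decide +kernel

lemma aux_bound (m : ℕ) : ∑ k ∈ Finset.Icc 1 m, Nat.lcmUpto m / k ≤ 3 ^ m := by
  rcases Nat.lt_or_ge 43 m with h | h
  · have h1 : Nat.lcmUpto m * m ≤ 3 ^ m := by
      rcases Nat.lt_or_ge m 4096 with h' | h'
      · exact aux_mid m h h'.le
      · exact aux_large m h'
    refine le_trans ?_ h1
    calc _ ≤ ∑ k ∈ Finset.Icc 1 m, Nat.lcmUpto m :=
          Finset.sum_le_sum fun k _ => Nat.div_le_self _ _
      _ = _ := by simp [mul_comm]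
  · revert m
    have : ∀ m ∈ Finset.range 44,
      ∑ k ∈ Finset.Icc 1 m, Nat.lcmUpto m / k ≤ 3 ^ m := by decide +kernel
    intro m hm
    exact this m (Finset.mem_range.2 (by omega))

theorem mul_prime_mem_goodSet_of_gt_three_pow
    (m : ℕ) (hm : 0 < m) (hmU : m ∈ goodSet)
    (p : ℕ) (hp : p.Prime) (hpg : 3 ^ m < p) :
    m * p ∈ goodSet := by
  have : Fact p.Prime := ⟨hp⟩
  have hp0 : 0 < p := hp.pos
  refine ⟨Nat.mul_pos hm hp0, ?_⟩
  intro w hw hsum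
  have hpQ : (p : ℚ) ≠ 0 := by exact_mod_cast hp0.ne'
  have hmQ : (m : ℚ) ≠ 0 := by exact_mod_cast hm.ne'
  have hmem : ∀ k ∈ Finset.Icc 1 (m - 1), k * p ∈ Finset.Icc 1 (m * p - 1) := by
    intro k hk
    simp only [Finset.mem_Icc] at hk ⊢
    have h1 : k * p + p ≤ m * p := by
      rw [← Nat.succ_mul]; exact Nat.mul_le_mul_right p (by omega)
    have h2 : 1 * p ≤ k * p := Nat.mul_le_mul_right p hk.1
    omega
  -- integer lifts
  have hwi : ∀ n ∈ Finset.Icc 1 (m * p - 1), ∃ z : ℤ, (z : ℚ) = w n ∧ |z| ≤ 1 := by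
    intro n hn
    have h := hw n hn
    simp only [Set.mem_insert_iff, Set.mem_singleton_iff] at h
    rcases h with h | h | h
    · exact ⟨-1, by simp [h], by simp⟩
    · exact ⟨0, by simp [h], by simp⟩
    · exact ⟨1, by simp [h], by simp⟩
  choose! v hv1 hv2 using hwi
  set T : ℚ := ∑ n ∈ (Finset.Icc 1 (m * p - 1)).filter (fun n => ¬ p ∣ n), w n / (n : ℚ) with hT
  set S : ℚ := ∑ k ∈ Finset.Icc 1 (m - 1), w (k * p) / (k : ℚ) with hS
  have hsplit : S / p + T = 1 / ((m : ℚ) * p) := by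
    rw [← Finset.sum_filter_add_sum_filter_not _ (fun n => p ∣ n)] at hsum
    push_cast at hsum
    rw [← hsum]
    congr 1
    rw [hS, Finset.sum_div]
    refine Finset.sum_bij (fun k _ => k * p) ?_ ?_ ?_ ?_
    · intro k hk
      rw [Finset.mem_filter]
      exact ⟨hmem k hk, Dvd.intro_left k rfl⟩
    · intro a _ b _ hab
      exact Nat.eq_of_mul_eq_mul_right hp0 hab
    · intro b hb
      rw [Finset.mem_filter, Finset.mem_Icc] at hb
      obtain ⟨⟨hb1, hb2⟩, c, rfl⟩ := hb
      refine ⟨c, ?_, mul_comm _ _⟩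
      rw [Finset.mem_Icc]
      have hc : c ≠ 0 := by rintro rfl; simp at hb1
      have hc2 : p * c < p * m := by rw [mul_comm p m]; omega
      have := Nat.lt_of_mul_lt_mul_left hc2
      omega
    · intro k _
      push_cast
      rw [div_div]
  have hTn : padicNorm p T ≤ 1 := by
    apply padicNorm.sum_le' _ zero_le_one
    intro n hn
    rw [Finset.mem_filter] at hn
    rw [← hv1 n hn.1, padicNorm.div, (padicNorm.nat_eq_one_iff n).2 hn.2, div_one]
    exact padicNorm.of_int _
  have hST : S - 1 / m = - (p * T) := by
    field_simp at hsplit ⊢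
    linarith
  set L := Nat.lcmUpto m with hL
  have hLpos : 0 < L := Nat.lcmUpto_pos m
  have hdvd : ∀ k ∈ Finset.Icc 1 m, k ∣ L := fun k hk => Finset.dvd_lcm (f := id) hk
  set Z : ℤ := ∑ k ∈ Finset.Icc 1 (m - 1), v (k * p) * ((L / k : ℕ) : ℤ) - ((L / m : ℕ) : ℤ)
    with hZ
  have hcast : ∀ k ∈ Finset.Icc 1 m, ((L / k : ℕ) : ℚ) = (L : ℚ) / k := by
    intro k hk
    have : (k : ℚ) ≠ 0 := by
      rw [Finset.mem_Icc] at hk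
      exact_mod_cast (by omega : k ≠ 0)
    exact Nat.cast_div (hdvd k hk) this
  have hZS : (Z : ℚ) = L * (S - 1 / m) := by
    rw [hZ, hS, mul_sub, Finset.mul_sum]
    push_cast
    congr 1
    · apply Finset.sum_congr rfl
      intro k hk
      have hk' : k ∈ Finset.Icc 1 m := by
        rw [Finset.mem_Icc] at hk ⊢; omega
      have h1 := hcast k hk'
      rw [hv1 _ (hmem k hk)]
      rw [← Int.natCast_div] 
      rw [Int.cast_natCast, h1]
      ring
    · have h1 := hcast m (by rw [Finset.mem_Icc]; omega)
      rw [← Int.natCast_div, Int.cast_natCast, h1]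
      ring
  have hpZ : (p : ℤ) ∣ Z := by
    have h1 : padicNorm p (Z : ℚ) ≤ (p : ℚ) ^ (-(1 : ℕ) : ℤ) := by
      rw [hZS, hST, padicNorm.mul, padicNorm.neg, padicNorm.mul, padicNorm.padicNorm_p_of_prime]
      have h2 : padicNorm p (L : ℚ) ≤ 1 := by exact_mod_cast padicNorm.of_int (p := p) (L : ℤ)
      have h3 : (0 : ℚ) ≤ (p : ℚ)⁻¹ := by positivity
      have h4 : (p : ℚ)⁻¹ * padicNorm p T ≤ (p : ℚ)⁻¹ := mul_le_of_le_one_right h3 hTn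
      simp only [Nat.cast_one, zpow_neg, zpow_one]
      exact (mul_le_of_le_one_left (mul_nonneg h3 (padicNorm.nonneg _)) h2).trans h4
    have := (padicNorm.dvd_iff_norm_le (p := p) (n := 1) (z := Z)).2 h1
    simpa using this
  have hZabs : |Z| ≤ ((3 ^ m : ℕ) : ℤ) := by
    have hb := aux_bound m
    have hm1 : m = (m - 1) + 1 := by omega
    have hins : ∑ k ∈ Finset.Icc 1 m, L / k = L / m + ∑ k ∈ Finset.Icc 1 (m - 1), L / k := by
      conv_lhs => rw [hm1]
      rw [← Finset.insert_Icc_right_eq_Icc_add_one (by omega), Finset.sum_insert (by simp),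
        ← hm1]
    rw [← hL, hins] at hb
    have hb' : ((L / m : ℕ) : ℤ) + ∑ k ∈ Finset.Icc 1 (m - 1), ((L / k : ℕ) : ℤ)
        ≤ ((3 ^ m : ℕ) : ℤ) := by exact_mod_cast hb
    refine le_trans ?_ hb'
    rw [hZ]
    refine (abs_sub _ _).trans ?_
    rw [add_comm]
    apply add_le_add
    · rw [abs_of_nonneg (by positivity)]
    · refine (Finset.abs_sum_le_sum_abs _ _).trans ?_
      apply Finset.sum_le_sum
      intro k hk
      rw [abs_mul, abs_of_nonneg (show (0 : ℤ) ≤ ((L / k : ℕ) : ℤ) by positivity)]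
      exact mul_le_of_le_one_left (by positivity) (hv2 _ (hmem k hk))
  have hZ0 : Z = 0 := by
    apply Int.eq_zero_of_abs_lt_dvd hpZ
    exact lt_of_le_of_lt hZabs (by exact_mod_cast hpg)
  have hS0 : S = 1 / m := by
    rw [hZ0] at hZS
    have : (L : ℚ) ≠ 0 := by exact_mod_cast hLpos.ne'
    have h2 := (mul_eq_zero.1 (hZS.symm.trans Int.cast_zero)).resolve_left this
    linarith
  exact hmU.2 (fun k => w (k * p)) (fun k hk => hw _ (hmem k hk)) hS0
end

section
/- Let y ≥ 1 and x ≥ 3^y be real numbers. Then #𝒰(x) ≥ ∑_{m ∈ 𝒰(y)} π(x/m) − 2·3^y, where π(t) denotes the number of primes not exceeding t. -/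
open Finset

/-- The crude bound `m * lcm(1..m) ≤ 81^(m-1)`. -/
lemma lcm_bound (m : ℕ) (hm : 1 ≤ m) : m * Nat.lcmUpto m ≤ 81 ^ (m - 1) := by
  rcases lt_or_ge m 10 with h | h
  · have h1 : Nat.lcmUpto m ≤ m.factorial :=
      Nat.le_of_dvd (Nat.factorial_pos m) (Nat.lcmUpto_dvd_factorial m)
    refine (Nat.mul_le_mul_left m h1).trans ?_
    clear h1
    interval_cases m <;> decide
  · have hmr : (10 : ℝ) ≤ m := by exact_mod_cast h
    have hmpos : (0 : ℝ) < m := by linarith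
    have hL : (0 : ℝ) < Nat.lcmUpto m := by exact_mod_cast Nat.lcmUpto_pos m
    have h2 := Chebyshev.psi_le (x := (m : ℝ)) (by linarith)
    rw [Chebyshev.psi_eq_log_lcmUpto] at h2
    set s := Real.sqrt m with hs
    have hss : s * s = m := Real.mul_self_sqrt hmpos.le
    have hs3 : 3 ≤ s := by
      rw [hs]; apply Real.le_sqrt_of_sq_le; linarith
    have l2a := Real.log_two_gt_d9
    have l2b := Real.log_two_lt_d9
    have l4 : Real.log 4 = 2 * Real.log 2 := by
      rw [show (4 : ℝ) = 2 ^ 2 by norm_num, Real.log_pow]; norm_num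
    have l64 : 6 * Real.log 2 ≤ Real.log 81 := by
      rw [show 6 * Real.log 2 = Real.log 64 by
        rw [show (64 : ℝ) = 2 ^ 6 by norm_num, Real.log_pow]; norm_num]
      exact Real.log_le_log (by norm_num) (by norm_num)
    have hlogs : Real.log m = 2 * Real.log s := by
      rw [← hss, Real.log_mul (by positivity) (by positivity)]; ring
    have hls : Real.log s ≤ s / 4 - 1 + 2 * Real.log 2 := by
      have := Real.log_le_sub_one_of_pos (show 0 < s / 4 by positivity)
      rw [Real.log_div (by positivity) (by norm_num), l4] at this
      linarith
    have hlm : Real.log m ≤ s / 2 + 0.774 := by rw [hlogs]; linarith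
    have hsl : s * Real.log m ≤ s * (s / 2 + 0.774) :=
      mul_le_mul_of_nonneg_left hlm (by linarith)
    have key : Real.log (m * Nat.lcmUpto m) ≤ Real.log (81 ^ (m - 1)) := by
      rw [Real.log_mul (by positivity) (by positivity), Real.log_pow, Nat.cast_sub hm, Nat.cast_one]
      have : ((m : ℝ) - 1) * (6 * Real.log 2) ≤ ((m : ℝ) - 1) * Real.log 81 :=
        mul_le_mul_of_nonneg_left l64 (by linarith)
      have h3 : ((m : ℝ) - 1) * 4.158 ≤ ((m : ℝ) - 1) * (6 * Real.log 2) :=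
        mul_le_mul_of_nonneg_left (by linarith) (by linarith)
      have h4 : Real.log 4 * m ≤ 1.3864 * m :=
        mul_le_mul_of_nonneg_right (by linarith) (by linarith)
      nlinarith
    have := (Real.log_le_log_iff (by positivity) (by positivity)).1 key
    exact_mod_cast this

/-- The scaled integer `D * (1/m - ∑ v k / k)`. -/
def numA (m : ℕ) (v : ℕ → ℤ) : ℤ :=
  ((Nat.lcmUpto m / m : ℕ) : ℤ) -
    ∑ k ∈ Icc 1 (m - 1), v k * ((Nat.lcmUpto m / k : ℕ) : ℤ)

lemma dvd_lcmUpto {k m : ℕ} (h1 : 1 ≤ k) (h2 : k ≤ m) : k ∣ Nat.lcmUpto m := by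
  have : id k ∣ (Icc 1 m).lcm id := Finset.dvd_lcm (mem_Icc.2 ⟨h1, h2⟩)
  exact this

lemma numA_cast (m : ℕ) (hm : 1 ≤ m) (v : ℕ → ℤ) :
    (numA m v : ℚ) = (Nat.lcmUpto m : ℚ) *
      (1 / (m : ℚ) - ∑ k ∈ Icc 1 (m - 1), (v k : ℚ) / (k : ℚ)) := by
  have hc : ∀ k : ℕ, 1 ≤ k → k ≤ m → ((Nat.lcmUpto m / k : ℕ) : ℚ) =
      (Nat.lcmUpto m : ℚ) / k := fun k h1 h2 =>
    Nat.cast_div (dvd_lcmUpto h1 h2) (by positivity)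
  unfold numA
  rw [Int.cast_sub, Int.cast_sum]
  simp only [Int.cast_mul, Int.cast_natCast]
  rw [hc m hm le_rfl, mul_sub, mul_sum]
  congr 1
  · ring
  · refine sum_congr rfl fun k hk => ?_
    rw [mem_Icc] at hk
    rw [hc k hk.1 (by omega)]
    ring

lemma numA_abs (m : ℕ) (hm : 1 ≤ m) (v : ℕ → ℤ) (hv : ∀ k ∈ Icc 1 (m - 1), |v k| ≤ 1) :
    (numA m v).natAbs ≤ m * Nat.lcmUpto m := by
  have hD : ∀ k : ℕ, ((Nat.lcmUpto m / k : ℕ) : ℤ) ≤ Nat.lcmUpto m := fun k => by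
    exact_mod_cast Nat.div_le_self _ _
  have h : |numA m v| ≤ (m : ℤ) * Nat.lcmUpto m := by
    unfold numA
    refine (abs_sub _ _).trans ?_
    have h1 : |∑ k ∈ Icc 1 (m - 1), v k * ((Nat.lcmUpto m / k : ℕ) : ℤ)| ≤
        ∑ k ∈ Icc 1 (m - 1), (Nat.lcmUpto m : ℤ) := by
      refine (abs_sum_le_sum_abs _ _).trans (sum_le_sum fun k hk => ?_)
      rw [abs_mul, Nat.abs_cast]
      calc _ ≤ 1 * ((Nat.lcmUpto m / k : ℕ) : ℤ) :=
            mul_le_mul_of_nonneg_right (hv k hk) (by positivity)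
        _ ≤ _ := by rw [one_mul]; exact hD k
    rw [sum_const, Nat.card_Icc, nsmul_eq_mul] at h1
    rw [Nat.abs_cast]
    have h2 := hD m
    have h3 : ((m - 1 + 1 - 1 : ℕ) : ℤ) = m - 1 := by omega
    rw [h3] at h1
    linarith
  have : ((numA m v).natAbs : ℤ) ≤ ((m * Nat.lcmUpto m : ℕ) : ℤ) := by
    rw [Int.natCast_natAbs]; push_cast; exact h
  exact_mod_cast this

/-- extension by zero of a dependent function -/
def extV (m : ℕ) (v : ∀ k ∈ Icc 1 (m - 1), ℤ) : ℕ → ℤ :=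
  fun k => if h : k ∈ Icc 1 (m - 1) then v k h else 0

def vecs (m : ℕ) : Finset (∀ k ∈ Icc 1 (m - 1), ℤ) :=
  (Icc 1 (m - 1)).pi fun _ => ({-1, 0, 1} : Finset ℤ)

lemma card_vecs (m : ℕ) : (vecs m).card = 3 ^ (m - 1) := by
  simp [vecs, Finset.card_pi]

/-- primes to be excluded for `m` -/
def badP (m : ℕ) : Finset ℕ :=
  Icc 1 (3 ^ (m - 1)) ∪ (vecs m).biUnion fun v =>
    (numA m (extV m v)).natAbs.primeFactors.filter (3 ^ (m - 1) < ·)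

lemma card_large_factors (a P : ℕ) (hP : 1 ≤ P) (ha : a ≤ P ^ 4) :
    (a.primeFactors.filter (P < ·)).card ≤ 3 := by
  by_contra! hc
  rcases Nat.eq_zero_or_pos a with rfl | hpos
  · simp at hc
  set s := a.primeFactors.filter (P < ·) with hs
  have h1 : ∏ p ∈ s, p ≤ a := by
    refine Nat.le_of_dvd hpos (dvd_trans ?_ (Nat.prod_primeFactors_dvd a))
    exact Finset.prod_dvd_prod_of_subset _ _ _ (filter_subset _ _)
  have h2 : (P + 1) ^ s.card ≤ ∏ p ∈ s, p := by
    apply Finset.pow_card_le_prod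
    intro p hp
    exact (mem_filter.1 hp).2
  have h3 : (P + 1) ^ 4 ≤ (P + 1) ^ s.card := Nat.pow_le_pow_right (by omega) hc
  have h4 : P ^ 4 < (P + 1) ^ 4 := Nat.pow_lt_pow_left (by omega) (by norm_num)
  omega

lemma card_badP (m : ℕ) (hm : 1 ≤ m) : (badP m).card ≤ 4 * 3 ^ (m - 1) := by
  unfold badP
  refine (card_union_le _ _).trans ?_
  have h : ((vecs m).biUnion fun v =>
    (numA m (extV m v)).natAbs.primeFactors.filter (3 ^ (m - 1) < ·)).card ≤
      (vecs m).card * 3 := by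
    apply Finset.card_biUnion_le_card_mul
    intro v hv
    apply card_large_factors _ _ (Nat.one_le_pow _ _ (by norm_num))
    calc _ ≤ m * Nat.lcmUpto m := by
          apply numA_abs m hm
          intro k hk
          have := (Finset.mem_pi.1 hv) k hk
          simp only [extV, hk, dif_pos]
          simp only [mem_insert, mem_singleton] at this
          rcases this with h | h | h <;> rw [h] <;> norm_num
      _ ≤ 81 ^ (m - 1) := lcm_bound m hm
      _ = _ := by rw [← pow_mul, mul_comm, pow_mul]; norm_num
  rw [card_vecs] at h
  rw [Nat.card_Icc]
  omega

lemma mul_mem_goodSet {m p : ℕ} (hm : m ∈ goodSet) (hp : p.Prime) (hb : p ∉ badP m) :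
    m * p ∈ goodSet := by
  obtain ⟨hm1, hmg⟩ := hm
  have hp0 : (p : ℚ) ≠ 0 := by exact_mod_cast hp.ne_zero
  refine ⟨Nat.mul_pos hm1 hp.pos, fun w hw hsum => hb ?_⟩
  haveI : Fact p.Prime := ⟨hp⟩
  have hmem : ∀ k ∈ Icc 1 (m - 1), p * k ∈ Icc 1 (m * p - 1) := by
    intro k hk
    rw [mem_Icc] at hk ⊢
    have h1 : p * 1 ≤ p * k := Nat.mul_le_mul_left p hk.1
    have h2 : p * k < p * m := Nat.mul_lt_mul_of_pos_left (by omega) hp.pos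
    have h3 := hp.pos
    rw [mul_comm m p]
    omega
  -- integer lift of w
  have hlift : ∀ n ∈ Icc 1 (m * p - 1), ∃ z : ℤ, z ∈ ({-1, 0, 1} : Finset ℤ) ∧ (z : ℚ) = w n := by
    intro n hn
    rcases hw n hn with h | h | h
    · exact ⟨-1, by simp, by rw [h]; norm_num⟩
    · exact ⟨0, by simp, by rw [h]; norm_num⟩
    · exact ⟨1, by simp, by rw [h]; norm_num⟩
  choose! z hz1 hz2 using hlift
  let v : ∀ k ∈ Icc 1 (m - 1), ℤ := fun k _ => z (p * k)
  have hv : v ∈ vecs m := Finset.mem_pi.2 fun k hk => hz1 _ (hmem k hk)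
  set S : ℚ := 1 / (m : ℚ) - ∑ k ∈ Icc 1 (m - 1), w (p * k) / (k : ℚ) with hS
  have hA : (numA m (extV m v) : ℚ) = (Nat.lcmUpto m : ℚ) * S := by
    rw [numA_cast m hm1]
    congr 2
    refine sum_congr rfl fun k hk => ?_
    simp only [extV, hk, dif_pos, v]
    rw [hz2 _ (hmem k hk)]
  have hS0 : S ≠ 0 := by
    intro h0
    refine hmg (fun k => w (p * k)) (fun k hk => hw _ (hmem k hk)) ?_
    rw [hS, sub_eq_zero] at h0
    exact h0.symm
  -- splitting
  have hsplit := Finset.sum_filter_add_sum_filter_not (Icc 1 (m * p - 1)) (fun n => p ∣ n)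
    (fun n => w n / (n : ℚ))
  have hmult : ∑ n ∈ (Icc 1 (m * p - 1)).filter (fun n => p ∣ n), w n / (n : ℚ) =
      ∑ k ∈ Icc 1 (m - 1), w (p * k) / ((p * k : ℕ) : ℚ) := by
    symm
    refine Finset.sum_bij (fun k _ => p * k) ?_ ?_ ?_ ?_
    · intro k hk
      exact mem_filter.2 ⟨hmem k hk, dvd_mul_right _ _⟩
    · intro a _ b _ hab
      exact Nat.eq_of_mul_eq_mul_left hp.pos hab
    · intro n hn
      obtain ⟨hn1, k, rfl⟩ := mem_filter.1 hn
      rw [mem_Icc] at hn1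
      refine ⟨k, ?_, rfl⟩
      rw [mem_Icc]
      have hk : 1 ≤ k := by
        rcases Nat.eq_zero_or_pos k with rfl | h
        · simp at hn1
        · exact h
      have : p * k < p * m := by rw [mul_comm p m]; omega
      have := Nat.lt_of_mul_lt_mul_left this
      omega
    · intro k _; rfl
  set T : ℚ := ∑ n ∈ (Icc 1 (m * p - 1)).filter (fun n => ¬ p ∣ n), w n / (n : ℚ) with hT
  have hST : S = p * T := by
    have h1 : ∑ k ∈ Icc 1 (m - 1), w (p * k) / ((p * k : ℕ) : ℚ) =
        (1 / (p : ℚ)) * ∑ k ∈ Icc 1 (m - 1), w (p * k) / (k : ℚ) := by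
      rw [mul_sum]
      refine sum_congr rfl fun k _ => ?_
      push_cast
      rw [div_mul_div_comm, one_mul]
    rw [hsum, hmult, h1] at hsplit
    have hm0 : (m : ℚ) ≠ 0 := by positivity
    have h2 : T = 1 / ((m * p : ℕ) : ℚ) -
      (1 / (p : ℚ)) * ∑ k ∈ Icc 1 (m - 1), w (p * k) / (k : ℚ) := by linarith
    rw [h2, hS]
    push_cast
    field_simp
  have hTn : padicNorm p T ≤ 1 := by
    refine padicNorm.sum_le' (fun n hn => ?_) zero_le_one
    obtain ⟨hn1, hn2⟩ := mem_filter.1 hn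
    rw [padicNorm.div, (padicNorm.nat_eq_one_iff n).2 hn2, div_one, ← hz2 n hn1]
    exact padicNorm.of_int _
  have hdvd : (p : ℤ) ∣ numA m (extV m v) := by
    rw [← padicNorm.int_lt_one_iff, hA, hST, padicNorm.mul, padicNorm.mul]
    have h1 := padicNorm.of_nat (p := p) (Nat.lcmUpto m)
    have h2 := padicNorm.padicNorm_p_lt_one_of_prime (p := p)
    calc _ ≤ 1 * (padicNorm p p * 1) := by
          apply mul_le_mul h1 _ (mul_nonneg (padicNorm.nonneg _) (padicNorm.nonneg _)) zero_le_one
          exact mul_le_mul_of_nonneg_left hTn (padicNorm.nonneg _)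
      _ < 1 := by simpa using h2
  have hne : numA m (extV m v) ≠ 0 := by
    intro h0
    rw [h0] at hA
    have hL : (Nat.lcmUpto m : ℚ) ≠ 0 := by exact_mod_cast Nat.lcmUpto_ne_zero m
    exact mul_ne_zero hL hS0 (by rw [← hA]; norm_num)
  unfold badP
  rw [mem_union]
  by_cases hle : p ≤ 3 ^ (m - 1)
  · left; exact mem_Icc.2 ⟨hp.one_le, hle⟩
  · right
    rw [mem_biUnion]
    refine ⟨v, hv, mem_filter.2 ⟨?_, by omega⟩⟩
    rw [Nat.mem_primeFactors]
    exact ⟨hp, Int.natCast_dvd.1 hdvd, by simpa using hne⟩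

lemma lt_of_notMem_badP {m p : ℕ} (hm : 1 ≤ m) (hp : p.Prime) (hb : p ∉ badP m) : m < p := by
  by_contra! h
  apply hb
  unfold badP
  refine mem_union_left _ (mem_Icc.2 ⟨hp.one_le, h.trans ?_⟩)
  have := Nat.lt_pow_self (n := m - 1) (show 1 < 3 by norm_num)
  omega

theorem goodSet_recursive_bound (y x : ℝ) (hy : 1 ≤ y) (hx : 3 ^ y ≤ x) :
    ((goodSet ∩ {n : ℕ | (n : ℝ) ≤ x}).ncard : ℝ) ≥
      (∑ᶠ m ∈ goodSet ∩ {n : ℕ | (n : ℝ) ≤ y},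
        (Nat.primeCounting ⌊x / (m : ℝ)⌋₊ : ℝ)) - 2 * 3 ^ y := by
  classical
  have hx0 : 0 ≤ x := le_trans (by positivity) hx
  set M := ⌊y⌋₊ with hM
  set S : Finset ℕ := (Icc 1 M).filter (· ∈ goodSet) with hS
  have hSset : goodSet ∩ {n : ℕ | (n : ℝ) ≤ y} = (S : Set ℕ) := by
    ext n
    simp only [Set.mem_inter_iff, Set.mem_ofPred_eq, hS, coe_filter, mem_Icc, hM]
    rw [Nat.le_floor_iff (by linarith)]
    constructor
    · rintro ⟨h1, h2⟩; exact ⟨⟨h1.1, h2⟩, h1⟩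
    · rintro ⟨⟨_, h2⟩, h1⟩; exact ⟨h1, h2⟩
  rw [hSset, finsum_mem_coe_finset]
  let G : ℕ → Finset ℕ := fun m => Nat.primesLE ⌊x / (m : ℝ)⌋₊ \ badP m
  have hG : ∀ m p, p ∈ G m → (p.Prime ∧ p ≤ ⌊x / (m : ℝ)⌋₊) ∧ p ∉ badP m := by
    intro m p h
    obtain ⟨h1, h2⟩ := mem_sdiff.1 h
    exact ⟨⟨Nat.prime_of_mem_primesLE h1, Nat.le_of_mem_primesLE h1⟩, h2⟩
  have hSg : ∀ m ∈ S, 1 ≤ m ∧ m ∈ goodSet := fun m hm =>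
    ⟨(mem_Icc.1 (mem_filter.1 hm).1).1, (mem_filter.1 hm).2⟩
  have hfin : (goodSet ∩ {n : ℕ | (n : ℝ) ≤ x}).Finite :=
    (Set.finite_Iic ⌊x⌋₊).subset fun n hn => Nat.le_floor hn.2
  have hinj : (S.sigma G).card ≤ (goodSet ∩ {n : ℕ | (n : ℝ) ≤ x}).ncard := by
    rw [Set.ncard_eq_toFinset_card _ hfin]
    refine Finset.card_le_card_of_injOn (fun q => q.1 * q.2) ?_ ?_
    · rintro ⟨m, p⟩ hq
      obtain ⟨h1, h2⟩ := mem_sigma.1 (mem_coe.1 hq)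
      obtain ⟨⟨hp, hle⟩, hb⟩ := hG m p h2
      obtain ⟨hm1, hmg⟩ := hSg m h1
      have hm0 : (0 : ℝ) < m := by exact_mod_cast hm1
      simp only [Set.Finite.coe_toFinset]
      refine ⟨mul_mem_goodSet hmg hp hb, ?_⟩
      have h3 : (p : ℝ) ≤ x / m := (Nat.le_floor_iff (by positivity)).1 hle
      rw [le_div_iff₀ hm0] at h3
      simp only [Set.mem_ofPred_eq]
      push_cast
      linarith
    · rintro ⟨m, p⟩ hq ⟨m', p'⟩ hq' heq
      obtain ⟨h1, h2⟩ := mem_sigma.1 (mem_coe.1 hq)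
      obtain ⟨h1', h2'⟩ := mem_sigma.1 (mem_coe.1 hq')
      obtain ⟨⟨hp, -⟩, hb⟩ := hG m p h2
      obtain ⟨⟨hp', -⟩, hb'⟩ := hG m' p' h2'
      have hm1 : 1 ≤ m := (hSg m h1).1
      have hm1' : 1 ≤ m' := (hSg m' h1').1
      have hlt := lt_of_notMem_badP hm1 hp hb
      have hlt' := lt_of_notMem_badP hm1' hp' hb'
      have heq : m * p = m' * p' := heq
      have hpp : p = p' := by
        by_contra hne
        have d1 : p ∣ m' * p' := heq ▸ dvd_mul_left p m
        have d2 : p' ∣ m * p := heq ▸ dvd_mul_left p' m'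
        have e1 : p ≤ m' := by
          rcases hp.dvd_mul.1 d1 with h | h
          · exact Nat.le_of_dvd hm1' h
          · exact absurd ((Nat.prime_dvd_prime_iff_eq hp hp').1 h) hne
        have e2 : p' ≤ m := by
          rcases hp'.dvd_mul.1 d2 with h | h
          · exact Nat.le_of_dvd hm1 h
          · exact absurd ((Nat.prime_dvd_prime_iff_eq hp' hp).1 h).symm hne
        omega
      subst hpp
      have : m = m' := Nat.eq_of_mul_eq_mul_right hp.pos heq
      subst this
      rfl
  rw [card_sigma] at hinj
  have hcount : ∑ m ∈ S, Nat.primeCounting ⌊x / (m : ℝ)⌋₊ ≤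
      ∑ m ∈ S, (G m).card + ∑ m ∈ S, 4 * 3 ^ (m - 1) := by
    rw [← sum_add_distrib]
    refine sum_le_sum fun m hm => ?_
    rw [← Nat.primesLE_card_eq_primeCounting]
    have h1 := Finset.le_card_sdiff (badP m) (Nat.primesLE ⌊x / (m : ℝ)⌋₊)
    have h2 := card_badP m (hSg m hm).1
    have h3 : (G m).card = (Nat.primesLE ⌊x / (m : ℝ)⌋₊ \ badP m).card := rfl
    omega
  have hgeom : ∀ k : ℕ, ∑ m ∈ Icc 1 k, 4 * 3 ^ (m - 1) + 2 = 2 * 3 ^ k := by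
    intro k
    induction k with
    | zero => simp
    | succ k ih =>
      rw [Finset.sum_Icc_succ_top (by omega), pow_succ, Nat.add_sub_cancel]
      omega
  have hsub : ∑ m ∈ S, 4 * 3 ^ (m - 1) ≤ ∑ m ∈ Icc 1 M, 4 * 3 ^ (m - 1) :=
    Finset.sum_le_sum_of_subset (filter_subset _ _)
  have htot : ∑ m ∈ S, Nat.primeCounting ⌊x / (m : ℝ)⌋₊ ≤
      (goodSet ∩ {n : ℕ | (n : ℝ) ≤ x}).ncard + 2 * 3 ^ M := by
    have := hgeom M
    omega
  have h3 : ((3 : ℝ) ^ M) ≤ 3 ^ y := by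
    rw [← Real.rpow_natCast]
    exact Real.rpow_le_rpow_of_exponent_le (by norm_num) (Nat.floor_le (by linarith))
  have htot' : ((∑ m ∈ S, Nat.primeCounting ⌊x / (m : ℝ)⌋₊ : ℕ) : ℝ) ≤
      (((goodSet ∩ {n : ℕ | (n : ℝ) ≤ x}).ncard + 2 * 3 ^ M : ℕ) : ℝ) := by exact_mod_cast htot
  push_cast at htot'
  linarith
end

section
/- For every integer k ≥ 2 there exist a constant c > 0 and x₀ (both depending on k) such that for all real x ≥ x₀, #𝒰(x) ≥ c · (x/log x) · ∏_{j=3}^{k} log_j x (for k = 2 the empty product is 1). -/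
open Finset

lemma int_of_mem {w : ℚ} (h : w ∈ ({-1, 0, 1} : Set ℚ)) : ∃ z : ℤ, w = z ∧ |z| ≤ 1 := by
  rcases h with h | h | h
  · exact ⟨-1, by simp [h], by simp⟩
  · exact ⟨0, by simp [h], by simp⟩
  · exact ⟨1, by simpa using h, by simp⟩

/-- multiplying a good number by a large prime gives a good number -/
lemma good_mul {m p : ℕ} (hm : m ∈ goodSet) (hp : p.Prime) (hlt : (m + 1).factorial < p) :
    p * m ∈ goodSet := by
  have : Fact p.Prime := ⟨hp⟩
  obtain ⟨hm1, hmw⟩ := hm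
  refine ⟨Nat.mul_pos hp.pos hm1, fun w hw hsum => ?_⟩
  have hp0 : (p : ℚ) ≠ 0 := by exact_mod_cast hp.ne_zero
  have hm0 : (m : ℚ) ≠ 0 := by exact_mod_cast (by omega : m ≠ 0)
  have hmem : ∀ j ∈ Finset.Icc 1 (m - 1), p * j ∈ Finset.Icc 1 (p * m - 1) := by
    intro j hj
    rw [Finset.mem_Icc] at hj ⊢
    have h1 : 1 ≤ p * j := Nat.mul_pos hp.pos hj.1
    have h2 : p * j < p * m := Nat.mul_lt_mul_of_pos_left (by omega) hp.pos
    omega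
  have hw' : ∀ j ∈ Finset.Icc 1 (m - 1), w (p * j) ∈ ({-1, 0, 1} : Set ℚ) :=
    fun j hj => hw _ (hmem j hj)
  apply hmw (fun j => w (p * j)) hw'
  -- split
  have hsplit := Finset.sum_filter_add_sum_filter_not (Finset.Icc 1 (p * m - 1)) (fun n => p ∣ n)
    (fun n => w n / (n : ℚ))
  have himg : (Finset.Icc 1 (p * m - 1)).filter (fun n => p ∣ n) =
      (Finset.Icc 1 (m - 1)).image (fun j => p * j) := by
    ext n
    simp only [Finset.mem_filter, Finset.mem_image]
    constructor
    · rintro ⟨hn, j, rfl⟩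
      refine ⟨j, ?_, rfl⟩
      rw [Finset.mem_Icc] at hn ⊢
      have h1 : 0 < j := by
        rcases Nat.eq_zero_or_pos j with h | h
        · subst h; simp at hn
        · exact h
      have h2 : j < m := by
        apply lt_of_mul_lt_mul_left (a := p) _ (Nat.zero_le _)
        omega
      omega
    · rintro ⟨j, hj, rfl⟩
      exact ⟨hmem j hj, dvd_mul_right _ _⟩
  rw [himg, Finset.sum_image (by
    intro a _ b _ h
    exact Nat.eq_of_mul_eq_mul_left hp.pos h), hsum] at hsplit
  set R := ∑ n ∈ (Finset.Icc 1 (p * m - 1)).filter (fun n => ¬ p ∣ n), w n / (n : ℚ) with hR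
  have hRn : padicNorm p R ≤ 1 := by
    apply padicNorm.sum_le'
    · intro n hn
      rw [Finset.mem_filter] at hn
      obtain ⟨z, hz, -⟩ := int_of_mem (hw n hn.1)
      rw [hz, padicNorm.div, (padicNorm.nat_eq_one_iff n).2 hn.2, div_one]
      exact padicNorm.of_int z
    · norm_num
  set S := ∑ j ∈ Finset.Icc 1 (m - 1), w (p * j) / (j : ℚ) with hS
  have hS' : ∑ j ∈ Finset.Icc 1 (m - 1), w (p * j) / ((p * j : ℕ) : ℚ) = S / p := by
    rw [hS, Finset.sum_div]
    refine Finset.sum_congr rfl fun j _ => ?_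
    push_cast
    rw [div_div, mul_comm (j : ℚ)]
  rw [hS'] at hsplit
  have hkey : 1 / (m : ℚ) - S = p * R := by
    have : R = 1 / ((p * m : ℕ) : ℚ) - S / p := by linarith
    rw [this]; push_cast; field_simp
  have hint : ∃ A : ℤ, (A : ℚ) = (m.factorial : ℚ) * (1 / (m : ℚ) - S) ∧
      |A| ≤ m.factorial * (m + 1) := by
    have hex : ∀ j ∈ Finset.Icc 1 (m - 1), ∃ B : ℤ,
        (B : ℚ) = m.factorial * (w (p * j) / (j : ℚ)) ∧ |B| ≤ m.factorial := by
      intro j hj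
      obtain ⟨z, hz, hz1⟩ := int_of_mem (hw' j hj)
      rw [Finset.mem_Icc] at hj
      obtain ⟨q, hq⟩ := Nat.dvd_factorial (by omega : 0 < j) (by omega : j ≤ m)
      have hj0 : (j : ℚ) ≠ 0 := by exact_mod_cast (by omega : j ≠ 0)
      refine ⟨z * q, ?_, ?_⟩
      · rw [hz, hq]; push_cast; field_simp
      · rw [abs_mul, hq]
        push_cast
        have h1 : |(q : ℤ)| = q := abs_of_nonneg (by positivity)
        rw [h1]
        have hj1 : (1 : ℤ) ≤ j := by exact_mod_cast hj.1
        have hq0 : (0 : ℤ) ≤ q := by positivity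
        nlinarith
    choose! B hB1 hB2 using hex
    obtain ⟨q, hq⟩ := Nat.dvd_factorial (by omega : 0 < m) le_rfl
    refine ⟨q - ∑ j ∈ Finset.Icc 1 (m - 1), B j, ?_, ?_⟩
    · rw [mul_sub, hS, Finset.mul_sum]
      push_cast
      rw [Finset.sum_congr rfl hB1]
      congr 1
      rw [hq]; push_cast; field_simp
    · have h1 : |∑ j ∈ Finset.Icc 1 (m - 1), B j| ≤ (m - 1 : ℕ) * (m.factorial : ℤ) := by
        refine (Finset.abs_sum_le_sum_abs _ _).trans ?_
        refine (Finset.sum_le_sum hB2).trans ?_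
        simp
      have h2 : |(q : ℤ)| ≤ m.factorial := by
        rw [abs_of_nonneg (by positivity)]
        exact_mod_cast (hq ▸ Nat.le_mul_of_pos_left q hm1)
      have h3 := abs_sub (q : ℤ) (∑ j ∈ Finset.Icc 1 (m - 1), B j)
      have h4 : ((m - 1 : ℕ) : ℤ) = m - 1 := by omega
      rw [h4] at h1
      have h5 : (0 : ℤ) ≤ m.factorial := by positivity
      nlinarith
  obtain ⟨A, hA, hAb⟩ := hint
  have hdvd : (p : ℤ) ∣ A := by
    have h1 := (padicNorm.dvd_iff_norm_le (p := p) (n := 1) (z := A)).2 (by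
      rw [hA, hkey, padicNorm.mul, padicNorm.mul, padicNorm.padicNorm_p_of_prime]
      have ha : padicNorm p (m.factorial : ℚ) ≤ 1 := by
        exact_mod_cast padicNorm.of_int (p := p) (m.factorial : ℤ)
      have hb : 0 ≤ padicNorm p (m.factorial : ℚ) := padicNorm.nonneg _
      have hc : 0 ≤ padicNorm p R := padicNorm.nonneg _
      have hpi : (0 : ℚ) ≤ (p : ℚ)⁻¹ := by positivity
      have : ((p : ℚ) ^ (-((1 : ℕ) : ℤ))) = (p : ℚ)⁻¹ := by simp
      rw [this]
      calc padicNorm p (m.factorial : ℚ) * ((p : ℚ)⁻¹ * padicNorm p R)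
          ≤ 1 * ((p : ℚ)⁻¹ * 1) := by gcongr
        _ = (p : ℚ)⁻¹ := by ring)
    simpa using h1
  have hA0 : A = 0 := by
    apply Int.eq_zero_of_abs_lt_dvd hdvd
    refine hAb.trans_lt ?_
    rw [Nat.factorial_succ] at hlt
    have : ((m + 1 : ℕ) : ℤ) * m.factorial < p := by exact_mod_cast hlt
    push_cast at this
    linarith
  rw [hA0] at hA
  have hf : (m.factorial : ℚ) ≠ 0 := by exact_mod_cast m.factorial_ne_zero
  have := (mul_eq_zero.1 (by simpa using hA.symm : (m.factorial : ℚ) * (1 / (m : ℚ) - S) = 0)).resolve_left hf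
  linarith

lemma one_good : 1 ∈ goodSet := by
  refine ⟨le_rfl, fun w _ => ?_⟩
  simp

open Classical in
/-- the good numbers up to `n` -/
noncomputable def gA (n : ℕ) : Finset ℕ := (Finset.Icc 1 n).filter (fun m => m ∈ goodSet)

lemma mem_gA {n m : ℕ} : m ∈ gA n ↔ (1 ≤ m ∧ m ≤ n) ∧ m ∈ goodSet := by
  simp [gA]

lemma ncard_eq {x : ℝ} (hx : 0 ≤ x) :
    (goodSet ∩ {n : ℕ | (n : ℝ) ≤ x}).ncard = (gA ⌊x⌋₊).card := by
  rw [← Set.ncard_coe_finset]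
  congr 1
  ext n
  simp only [Set.mem_inter_iff, Set.mem_ofPred_eq, Finset.mem_coe, mem_gA, Nat.le_floor_iff hx]
  constructor
  · rintro ⟨h1, h2⟩
    exact ⟨⟨h1.1, h2⟩, h1⟩
  · rintro ⟨h1, h2⟩
    exact ⟨h2, h1.2⟩

lemma primes_card (s n : ℕ) :
    (Nat.primeCounting n : ℝ) - s ≤ (((Finset.Ioc s n).filter Nat.Prime).card : ℝ) := by
  have h : Nat.primeCounting n ≤ ((Finset.Ioc s n).filter Nat.Prime).card + s := by
    rw [Nat.primeCounting, Nat.primeCounting', Nat.count_eq_card_filter_range]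
    calc _ ≤ (((Finset.Ioc s n).filter Nat.Prime) ∪ Finset.Icc 1 s).card := by
          apply Finset.card_le_card
          intro p hp
          simp only [Finset.mem_filter, Finset.mem_range, Finset.mem_union, Finset.mem_Ioc,
            Finset.mem_Icc] at hp ⊢
          have := hp.2.pos
          by_cases h : s < p
          · left; exact ⟨⟨h, by omega⟩, hp.2⟩
          · right; omega
      _ ≤ _ := (Finset.card_union_le _ _).trans (by simp)
  have : (Nat.primeCounting n : ℝ) ≤ ((Finset.Ioc s n).filter Nat.Prime).card + s := by
    exact_mod_cast h
  linarith

lemma count_lower (x : ℝ) (hx : 0 ≤ x) (Y s : ℕ) (hs : (Y + 1).factorial ≤ s) :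
    ∑ m ∈ gA Y, ((Nat.primeCounting ⌊x / m⌋₊ : ℝ) - s) ≤ ((gA ⌊x⌋₊).card : ℝ) := by
  have h1 : ((gA Y).sigma (fun m => (Finset.Ioc s ⌊x / m⌋₊).filter Nat.Prime)).card
      ≤ (gA ⌊x⌋₊).card := by
    apply Finset.card_le_card_of_injOn (fun q => q.2 * q.1)
    · rintro ⟨m, p⟩ h
      simp only [Finset.coe_sigma, Set.mem_sigma_iff, Finset.mem_coe, mem_gA, Finset.mem_filter,
        Finset.mem_Ioc] at h ⊢
      obtain ⟨⟨⟨hm1, hmY⟩, hm⟩, ⟨hsp, hpx⟩, hp⟩ := h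
      have hgood : p * m ∈ goodSet := good_mul hm hp
        (lt_of_le_of_lt ((Nat.factorial_le (by omega)).trans hs) hsp)
      refine ⟨⟨hgood.1, ?_⟩, hgood⟩
      have hm0 : (0 : ℝ) < m := by exact_mod_cast hm1
      rw [Nat.le_floor_iff (by positivity), le_div_iff₀ hm0] at hpx
      rw [Nat.le_floor_iff hx]
      exact_mod_cast hpx
    · rintro ⟨m, p⟩ h ⟨m', p'⟩ h' heq
      simp only [Finset.coe_sigma, Set.mem_sigma_iff, Finset.mem_coe, mem_gA, Finset.mem_filter,
        Finset.mem_Ioc] at h h' heq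
      obtain ⟨⟨⟨hm1, hmY⟩, hm⟩, ⟨hsp, hpx⟩, hp⟩ := h
      obtain ⟨⟨⟨hm1', hmY'⟩, hm'⟩, ⟨hsp', hpx'⟩, hp'⟩ := h'
      have hY := Nat.self_le_factorial (Y + 1)
      have hpp : p = p' := by
        have hd : p ∣ p' * m' := heq ▸ dvd_mul_right p m
        rcases hp.dvd_mul.1 hd with h | h
        · exact (Nat.prime_dvd_prime_iff_eq hp hp').1 h
        · have := Nat.le_of_dvd hm1' h
          omega
      subst hpp
      have := Nat.eq_of_mul_eq_mul_left hp.pos heq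
      subst this
      rfl
  rw [Finset.card_sigma] at h1
  calc _ ≤ ∑ m ∈ gA Y, (((Finset.Ioc s ⌊x / m⌋₊).filter Nat.Prime).card : ℝ) :=
        Finset.sum_le_sum fun m _ => primes_card _ _
    _ ≤ _ := by exact_mod_cast h1

lemma pi_lower {t : ℝ} (ht : 10 ≤ t) :
    (1 / 4) * t / Real.log t ≤ (Nat.primeCounting ⌊t⌋₊ : ℝ) := by
  refine le_trans ?_ (Chebyshev.pi_ge' (by linarith))
  have hl : 0 < Real.log t := Real.log_pos (by linarith)
  gcongr
  have h1 := Real.log_le_sub_one_of_pos (x := (t + 2) / 8) (by linarith)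
  rw [Real.log_div (by linarith) (by norm_num)] at h1
  have h8 : Real.log 8 = 3 * Real.log 2 := by
    rw [show (8 : ℝ) = 2 ^ 3 by norm_num, Real.log_pow]; norm_num
  have h2 := Real.log_two_gt_d9
  have h3 := Real.log_two_lt_d9
  nlinarith

open Filter in
lemma ev_sq : ∀ᶠ x : ℝ in atTop, 8 * (Real.log x) ^ 2 ≤ Real.sqrt x := by
  have h := (isLittleO_log_rpow_atTop (show (0 : ℝ) < 1 / 4 by norm_num)).bound
    (show (0 : ℝ) < 1 / 3 by norm_num)
  filter_upwards [h, eventually_ge_atTop 1] with x hx hx1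
  have hx0 : 0 ≤ x := by linarith
  have hl : 0 ≤ Real.log x := Real.log_nonneg hx1
  rw [Real.norm_of_nonneg hl, Real.norm_of_nonneg (by positivity)] at hx
  have h2 : (x ^ (1 / 4 : ℝ)) ^ 2 = Real.sqrt x := by
    rw [Real.sqrt_eq_rpow, ← Real.rpow_natCast, ← Real.rpow_mul hx0]
    norm_num
  rw [← h2]
  have h0 : 0 ≤ x ^ (1 / 4 : ℝ) := by positivity
  nlinarith

lemma main_count_aux {x : ℝ} (hl : 4 ≤ Real.log x) (hsq : 8 * (Real.log x) ^ 2 ≤ Real.sqrt x) :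
    (1 / 8) * (x / Real.log x) * ∑ m ∈ gA ⌊Real.sqrt (Real.log x) / 2⌋₊, 1 / (m : ℝ) ≤
      ((gA ⌊x⌋₊).card : ℝ) := by
  set l := Real.log x with hldef
  have hx0 : 0 < x := by
    by_contra h
    have : Real.sqrt x = 0 := Real.sqrt_eq_zero_of_nonpos (by linarith)
    nlinarith
  have hxs : Real.sqrt x * Real.sqrt x = x := Real.mul_self_sqrt hx0.le
  have hls : Real.sqrt l * Real.sqrt l = l := Real.mul_self_sqrt (by linarith)
  have hs0 : 0 ≤ Real.sqrt l := Real.sqrt_nonneg _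
  have hs2 : 2 ≤ Real.sqrt l := by
    apply Real.le_sqrt_of_sq_le; linarith
  set Y := ⌊Real.sqrt l / 2⌋₊ with hY
  have hYle : (Y : ℝ) ≤ Real.sqrt l / 2 := Nat.floor_le (by positivity)
  have hY1 : 1 ≤ Y := by
    rw [hY, Nat.le_floor_iff (by positivity)]; push_cast; linarith
  have hfac : (Y + 1).factorial ≤ ⌊Real.sqrt x⌋₊ := by
    rw [Nat.le_floor_iff (by positivity)]
    have h1 : (((Y + 1).factorial : ℕ) : ℝ) ≤ ((Y : ℝ) + 1) ^ (Y + 1) := by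
      exact_mod_cast Nat.factorial_le_pow (Y + 1)
    have h2 : ((Y : ℝ) + 1) ^ (Y + 1) ≤ (Real.exp Y) ^ (Y + 1) := by
      gcongr
      exact Real.add_one_le_exp _
    have h3 : (Real.exp Y) ^ (Y + 1) ≤ Real.exp (l / 2) := by
      rw [← Real.exp_nat_mul]
      apply Real.exp_le_exp.2
      have hY1' : (1 : ℝ) ≤ Y := by exact_mod_cast hY1
      push_cast
      nlinarith
    have h4 : Real.exp (l / 2) = Real.sqrt x := by
      rw [Real.exp_half, hldef, Real.exp_log hx0]
    linarith
  refine le_trans ?_ (count_lower x hx0.le Y _ hfac)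
  rw [Finset.mul_sum]
  apply Finset.sum_le_sum
  intro m hm
  rw [mem_gA] at hm
  obtain ⟨⟨hm1, hmY⟩, -⟩ := hm
  have hm1' : (1 : ℝ) ≤ m := by exact_mod_cast hm1
  have hmY' : (m : ℝ) ≤ Y := by exact_mod_cast hmY
  have hml : (m : ℝ) ≤ l := by nlinarith
  have hm0 : (0 : ℝ) < m := by linarith
  have hl0 : 0 < l := by linarith
  have hs : (⌊Real.sqrt x⌋₊ : ℝ) ≤ Real.sqrt x := Nat.floor_le (by positivity)
  have hsx : 0 ≤ Real.sqrt x := Real.sqrt_nonneg _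
  have h8 : Real.sqrt x ≤ (1 / 8) * (x / l) * (1 / m) := by
    have : (1 / 8) * (x / l) * (1 / (m : ℝ)) = x / (8 * l * m) := by field_simp
    rw [this, le_div_iff₀ (by positivity)]
    have h9 : 8 * l * m ≤ Real.sqrt x := by nlinarith
    nlinarith
  have hxm : 10 ≤ x / m := by
    rw [le_div_iff₀ hm0]
    have h9 : 10 * l ≤ Real.sqrt x := by nlinarith
    have h10 : 1 ≤ Real.sqrt x := by nlinarith
    nlinarith
  have hlog : Real.log (x / m) ≤ l := by
    apply Real.log_le_log (by positivity)
    exact div_le_self hx0.le hm1'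
  have hlogp : 0 < Real.log (x / m) := Real.log_pos (by linarith)
  have hpi := pi_lower hxm
  have h10 : (1 / 4) * (x / m) / l ≤ (1 / 4) * (x / m) / Real.log (x / m) := by
    gcongr
  have h11 : (1 / 4) * (x / m) / l = 2 * ((1 / 8) * (x / l) * (1 / m)) := by
    field_simp; norm_num
  linarith

lemma partial_summation (Y : ℕ) : ∑ m ∈ gA Y, 1 / (m : ℝ) =
    ((gA Y).card : ℝ) / (Y + 1) +
      ∑ m ∈ Finset.Icc 1 Y, ((gA m).card : ℝ) / ((m : ℝ) * (m + 1)) := by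
  induction Y with
  | zero => simp [gA]
  | succ Y ih =>
    rw [Finset.sum_Icc_succ_top (by omega)]
    have h0 : (Y : ℝ) + 1 ≠ 0 := by positivity
    have h1 : (Y : ℝ) + 1 + 1 ≠ 0 := by positivity
    by_cases h : Y + 1 ∈ goodSet
    · have hg : gA (Y + 1) = insert (Y + 1) (gA Y) := by
        ext n
        simp only [mem_gA, Finset.mem_insert]
        constructor
        · rintro ⟨h1, h2⟩
          by_cases hn : n = Y + 1
          · exact Or.inl hn
          · exact Or.inr ⟨⟨h1.1, by omega⟩, h2⟩
        · rintro (rfl | ⟨h1, h2⟩)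
          · exact ⟨⟨by omega, le_rfl⟩, h⟩
          · exact ⟨⟨h1.1, by omega⟩, h2⟩
      have hn : Y + 1 ∉ gA Y := by rw [mem_gA]; omega
      rw [hg, Finset.sum_insert hn, Finset.card_insert_of_notMem hn, ih]
      push_cast
      field_simp
      ring
    · have hg : gA (Y + 1) = gA Y := by
        ext n
        simp only [mem_gA]
        constructor
        · rintro ⟨h1, h2⟩
          have : n ≠ Y + 1 := by rintro rfl; exact h h2
          exact ⟨⟨h1.1, by omega⟩, h2⟩
        · rintro ⟨h1, h2⟩
          exact ⟨⟨h1.1, by omega⟩, h2⟩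
      rw [hg, ih]
      push_cast
      field_simp
      ring

lemma loglog_step {m : ℕ} (hm : 2 ≤ m) :
    Real.log (Real.log ((m : ℝ) + 1)) - Real.log (Real.log m) ≤ 1 / (m * Real.log m) := by
  have hm' : (2 : ℝ) ≤ m := by exact_mod_cast hm
  have h0 : 0 < Real.log m := Real.log_pos (by linarith)
  have h1 : 0 < Real.log ((m : ℝ) + 1) := Real.log_pos (by linarith)
  rw [← Real.log_div h1.ne' h0.ne']
  refine (Real.log_le_sub_one_of_pos (by positivity)).trans ?_
  have h2 : Real.log ((m : ℝ) + 1) - Real.log m ≤ 1 / m := by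
    rw [← Real.log_div (by positivity) (by positivity)]
    refine (Real.log_le_sub_one_of_pos (by positivity)).trans ?_
    apply le_of_eq
    field_simp
    ring
  have h3 : Real.log ((m : ℝ) + 1) / Real.log m - 1 =
      (Real.log ((m : ℝ) + 1) - Real.log m) / Real.log m := by field_simp
  rw [h3, ← div_div]
  gcongr

lemma loglog_sum {Z : ℕ} (hZ : 1 ≤ Z) (Y : ℕ) (h : Z ≤ Y) :
    Real.log (Real.log ((Y : ℝ) + 1)) - Real.log (Real.log ((Z : ℝ) + 1)) ≤
      ∑ m ∈ Finset.Ioc Z Y, 1 / ((m : ℝ) * Real.log m) := by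
  induction Y, h using Nat.le_induction with
  | base => simp
  | succ Y hY ih =>
    rw [Finset.sum_Ioc_succ_top (by omega)]
    have := loglog_step (m := Y + 1) (by omega)
    push_cast at this ⊢
    linarith

open Filter in
lemma iter_tendsto (j : ℕ) : Tendsto (Real.log^[j]) atTop atTop :=
  Tendsto.iterate Real.tendsto_log_atTop j

open Filter in
lemma iter_lower (j : ℕ) : ∀ᶠ x : ℝ in atTop, ∀ t : ℝ,
    Real.exp (Real.sqrt (Real.log (Real.log x))) ≤ t →
      (1 / 2) * Real.log^[j + 3] x ≤ Real.log^[j + 2] t := by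
  induction j with
  | zero =>
    filter_upwards [(iter_tendsto 2).eventually_ge_atTop 1] with x hx t ht
    simp only [Function.iterate_succ, Function.iterate_zero, Function.comp, id] at hx ⊢
    have h1 : Real.sqrt (Real.log (Real.log x)) ≤ Real.log t := by
      rw [← Real.log_exp (Real.sqrt _)]
      exact Real.log_le_log (Real.exp_pos _) ht
    have h2 : 0 < Real.sqrt (Real.log (Real.log x)) := Real.sqrt_pos.2 (by linarith)
    have h3 := Real.log_le_log h2 h1
    rw [Real.log_sqrt (by linarith)] at h3
    linarith
  | succ j ih =>
    filter_upwards [ih, (iter_tendsto (j + 3)).eventually_ge_atTop 4] with x hx hb t ht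
    have h1 := hx t ht
    rw [show j + 1 + 3 = (j + 3) + 1 by ring, show j + 1 + 2 = (j + 2) + 1 by ring,
      Function.iterate_succ_apply' _ (j + 3) x, Function.iterate_succ_apply' _ (j + 2) t]
    set b := Real.log^[j + 3] x
    have h2 := Real.log_le_log (by linarith) h1
    rw [Real.log_mul (by norm_num) (by linarith)] at h2
    have h3 : Real.log (1 / 2) = - Real.log 2 := by simp
    have h4 := Real.log_le_log (by norm_num) hb
    have h5 : Real.log 4 = 2 * Real.log 2 := by
      rw [show (4 : ℝ) = 2 ^ 2 by norm_num, Real.log_pow]; norm_num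
    linarith

lemma prod_shift (f : ℕ → ℝ) (k : ℕ) (hk : 2 ≤ k) :
    ∏ j ∈ Finset.Icc 3 (k + 1), f j = f 3 * ∏ j ∈ Finset.Icc 3 k, f (j + 1) := by
  induction k, hk using Nat.le_induction with
  | base => simp
  | succ k hk ih =>
    rw [Finset.prod_Icc_succ_top (by omega), ih, Finset.prod_Icc_succ_top (by omega), mul_assoc]

/-- the inductive step for a single `x` -/
lemma step_aux {k : ℕ} (hk : 2 ≤ k) {c N0 x : ℝ} (hc : 0 < c)
    (hN : ∀ t : ℝ, N0 ≤ t →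
      c * (t / Real.log t) * ∏ j ∈ Finset.Icc 3 k, Real.log^[j] t ≤ ((gA ⌊t⌋₊).card : ℝ))
    (hl : 4 ≤ Real.log x) (hsq : 8 * (Real.log x) ^ 2 ≤ Real.sqrt x)
    (hl2 : 4 ≤ Real.log (Real.log x))
    (hl3 : 12 ≤ Real.log (Real.log (Real.log x)))
    (hE : N0 ≤ Real.exp (Real.sqrt (Real.log (Real.log x))))
    (hit : ∀ j ∈ Finset.Icc 3 k, ∀ t : ℝ,
      Real.exp (Real.sqrt (Real.log (Real.log x))) ≤ t →
        (1 / 2) * Real.log^[j + 1] x ≤ Real.log^[j] t)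
    (hpos : ∀ j ∈ Finset.Icc 3 k, 0 ≤ Real.log^[j + 1] x) :
    (1 / 64 * c * (1 / 2) ^ (Finset.Icc 3 k).card) * (x / Real.log x) *
      ∏ j ∈ Finset.Icc 3 (k + 1), Real.log^[j] x ≤ ((gA ⌊x⌋₊).card : ℝ) := by
  refine le_trans ?_ (main_count_aux hl hsq)
  rw [prod_shift _ k hk]
  have e3 : Real.log^[3] x = Real.log (Real.log (Real.log x)) := rfl
  rw [e3]
  have hx0 : 0 < x := by
    by_contra h
    have : Real.sqrt x = 0 := Real.sqrt_eq_zero_of_nonpos (by linarith)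
    nlinarith
  set l := Real.log x
  set l2 := Real.log l
  set l3 := Real.log l2
  set E := Real.exp (Real.sqrt l2) with hEdef
  set Y := ⌊Real.sqrt l / 2⌋₊ with hY
  set Z := ⌈E⌉₊ with hZ
  have hlog2 := Real.log_two_lt_d9
  have hlog2' := Real.log_two_gt_d9
  have hlog4 : Real.log 4 = 2 * Real.log 2 := by
    rw [show (4 : ℝ) = 2 ^ 2 by norm_num, Real.log_pow]; norm_num
  have hs2 : 2 ≤ Real.sqrt l2 := by
    apply Real.le_sqrt_of_sq_le; linarith
  have hE3 : 3 ≤ E := by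
    have := Real.add_one_le_exp (Real.sqrt l2)
    linarith
  have hZE : E ≤ Z := Nat.le_ceil _
  have hZE' : (Z : ℝ) < E + 1 := Nat.ceil_lt_add_one (by linarith)
  have hZ1 : 1 ≤ Z := by
    have : (1 : ℝ) ≤ Z := by linarith
    exact_mod_cast this
  have hlogZ : Real.log ((Z : ℝ) + 1) ≤ 2 * Real.sqrt l2 := by
    have h1 : (Z : ℝ) + 1 ≤ E ^ 2 := by nlinarith
    have h2 := Real.log_le_log (by positivity) h1
    rw [Real.log_pow, hEdef, Real.log_exp] at h2
    exact_mod_cast h2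
  have hlogZ0 : 0 < Real.log ((Z : ℝ) + 1) := Real.log_pos (by linarith)
  have hllZ : Real.log (Real.log ((Z : ℝ) + 1)) ≤ Real.log 2 + l3 / 2 := by
    have h2 := Real.log_le_log hlogZ0 hlogZ
    rwa [Real.log_mul (by norm_num) (by linarith), Real.log_sqrt (by linarith)] at h2
  have hlogY : l2 / 4 ≤ Real.log ((Y : ℝ) + 1) := by
    have h1 : Real.sqrt l / 2 ≤ (Y : ℝ) + 1 := (Nat.lt_floor_add_one _).le
    have h0 : 0 < Real.sqrt l := Real.sqrt_pos.2 (by linarith)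
    have h2 := Real.log_le_log (by positivity) h1
    rw [Real.log_div h0.ne' (by norm_num), Real.log_sqrt (by linarith)] at h2
    change l2 / 2 - Real.log 2 ≤ _ at h2
    linarith
  have hllY : l3 - Real.log 4 ≤ Real.log (Real.log ((Y : ℝ) + 1)) := by
    have h2 := Real.log_le_log (by linarith) hlogY
    rwa [Real.log_div (by linarith) (by norm_num)] at h2
  have hZY : Z ≤ Y := by
    by_contra hcon
    have h1 : (Y : ℝ) + 1 ≤ (Z : ℝ) + 1 := by
      have : (Y : ℝ) ≤ Z := by exact_mod_cast (by omega : Y ≤ Z)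
      linarith
    have h2 := Real.log_le_log (by positivity) h1
    have h3 := Real.log_le_log (by linarith) h2
    linarith
  have hsum := loglog_sum hZ1 Y hZY
  set P := ∏ j ∈ Finset.Icc 3 k, Real.log^[j + 1] x with hP
  have hP0 : 0 ≤ P := Finset.prod_nonneg hpos
  set q : ℝ := (1 / 2) ^ (Finset.Icc 3 k).card with hq
  have hq0 : 0 < q := by positivity
  have hterm : ∀ m ∈ Finset.Ioc Z Y, c * q * P / 2 * (1 / ((m : ℝ) * Real.log m)) ≤
      ((gA m).card : ℝ) / ((m : ℝ) * (m + 1)) := by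
    intro m hm
    rw [Finset.mem_Ioc] at hm
    have hmZ : (Z : ℝ) ≤ m := by exact_mod_cast hm.1.le
    have hmE : E ≤ m := by linarith
    have h1 := hN m (by linarith)
    rw [Nat.floor_natCast] at h1
    have h2 : q * P ≤ ∏ j ∈ Finset.Icc 3 k, Real.log^[j] (m : ℝ) := by
      rw [hq, hP, ← Finset.prod_const, ← Finset.prod_mul_distrib]
      apply Finset.prod_le_prod
      · intro j hj
        have := hpos j hj
        positivity
      · intro j hj
        exact hit j hj m hmE
    have hm0 : (0 : ℝ) < m := by linarith
    have hlm : 0 < Real.log m := Real.log_pos (by linarith)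
    have h3 : c * (m / Real.log m) * (q * P) ≤ ((gA m).card : ℝ) := by
      refine le_trans ?_ h1
      gcongr
    calc c * q * P / 2 * (1 / ((m : ℝ) * Real.log m))
        = c * (m / Real.log m) * (q * P) / (m * (2 * m)) := by field_simp
      _ ≤ c * (m / Real.log m) * (q * P) / (m * (m + 1)) := by
          gcongr
          linarith
      _ ≤ _ := by gcongr
  have hS : c * q * P / 2 * (l3 / 4) ≤ ∑ m ∈ gA Y, 1 / (m : ℝ) := by
    rw [partial_summation]
    have h1 : ∑ m ∈ Finset.Ioc Z Y, ((gA m).card : ℝ) / ((m : ℝ) * (m + 1)) ≤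
        ∑ m ∈ Finset.Icc 1 Y, ((gA m).card : ℝ) / ((m : ℝ) * (m + 1)) := by
      apply Finset.sum_le_sum_of_subset_of_nonneg
      · intro m hm
        rw [Finset.mem_Ioc] at hm
        rw [Finset.mem_Icc]
        omega
      · intros
        positivity
    have h2 := Finset.sum_le_sum hterm
    rw [← Finset.mul_sum] at h2
    have h3 : c * q * P / 2 * (l3 / 4) ≤
        c * q * P / 2 * ∑ m ∈ Finset.Ioc Z Y, 1 / ((m : ℝ) * Real.log m) := by
      gcongr
      linarith
    have h4 : 0 ≤ ((gA Y).card : ℝ) / (Y + 1) := by positivity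
    linarith
  have hxl : 0 ≤ 1 / 8 * (x / l) := by positivity
  calc _ = 1 / 8 * (x / l) * (c * q * P / 2 * (l3 / 4)) := by ring
    _ ≤ _ := by gcongr

open Filter in
lemma main_ev (k : ℕ) (hk : 2 ≤ k) : ∃ c : ℝ, 0 < c ∧ ∀ᶠ x : ℝ in atTop,
    c * (x / Real.log x) * ∏ j ∈ Finset.Icc 3 k, Real.log^[j] x ≤ ((gA ⌊x⌋₊).card : ℝ) := by
  induction k, hk using Nat.le_induction with
  | base =>
    refine ⟨1 / 8, by norm_num, ?_⟩
    filter_upwards [ev_sq, Real.tendsto_log_atTop.eventually_ge_atTop 4,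
      eventually_ge_atTop 0] with x hsq hl hx
    refine le_trans ?_ (main_count_aux hl hsq)
    have h1 : (1 : ℝ) ≤ ∑ m ∈ gA ⌊Real.sqrt (Real.log x) / 2⌋₊, 1 / (m : ℝ) := by
      have hs2 : 2 ≤ Real.sqrt (Real.log x) := by
        apply Real.le_sqrt_of_sq_le; linarith
      have hmem : 1 ∈ gA ⌊Real.sqrt (Real.log x) / 2⌋₊ := by
        rw [mem_gA]
        refine ⟨⟨le_rfl, ?_⟩, one_good⟩
        rw [Nat.le_floor_iff (by positivity)]
        push_cast
        linarith
      have := Finset.single_le_sum (f := fun m : ℕ => 1 / (m : ℝ))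
        (fun i _ => by positivity) hmem
      simpa using this
    have hxl : 0 ≤ 1 / 8 * (x / Real.log x) := by positivity
    have : ∏ j ∈ Finset.Icc 3 2, Real.log^[j] x = 1 := by simp
    rw [this]
    gcongr
  | succ k hk ih =>
    obtain ⟨c, hc, hev⟩ := ih
    obtain ⟨N0, hN⟩ := eventually_atTop.1 hev
    refine ⟨1 / 64 * c * (1 / 2) ^ (Finset.Icc 3 k).card, by positivity, ?_⟩
    have hE : Tendsto (fun x : ℝ => Real.exp (Real.sqrt (Real.log (Real.log x)))) atTop atTop :=
      Real.tendsto_exp_atTop.comp (Real.tendsto_sqrt_atTop.comp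
        (Real.tendsto_log_atTop.comp Real.tendsto_log_atTop))
    have hit : ∀ᶠ x : ℝ in atTop, ∀ j ∈ Finset.Icc 3 k, ∀ t : ℝ,
        Real.exp (Real.sqrt (Real.log (Real.log x))) ≤ t →
          (1 / 2) * Real.log^[j + 1] x ≤ Real.log^[j] t := by
      rw [Filter.eventually_all_finset]
      intro j hj
      rw [Finset.mem_Icc] at hj
      obtain ⟨i, rfl⟩ : ∃ i, j = i + 2 := ⟨j - 2, by omega⟩
      exact iter_lower i
    have hpos : ∀ᶠ x : ℝ in atTop, ∀ j ∈ Finset.Icc 3 k, 0 ≤ Real.log^[j + 1] x := by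
      rw [Filter.eventually_all_finset]
      intro j _
      exact (iter_tendsto (j + 1)).eventually_ge_atTop 0
    filter_upwards [ev_sq, (iter_tendsto 1).eventually_ge_atTop 4,
      (iter_tendsto 2).eventually_ge_atTop 4, (iter_tendsto 3).eventually_ge_atTop 12,
      hE.eventually_ge_atTop N0, hit, hpos] with x h1 h2 h3 h4 h5 h6 h7
    exact step_aux hk hc hN h2 h1 h3 h4 h5 h6 h7

theorem goodSet_lower_bound (k : ℕ) (hk : 2 ≤ k) :
    ∃ c : ℝ, 0 < c ∧ ∃ x₀ : ℝ, ∀ x : ℝ, x₀ ≤ x →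
      ((goodSet ∩ {n : ℕ | (n : ℝ) ≤ x}).ncard : ℝ) ≥
        c * (x / Real.log x) * ∏ j ∈ Finset.Icc 3 k, Real.log^[j] x := by
  obtain ⟨c, hc, hev⟩ := main_ev k hk
  obtain ⟨N0, hN⟩ := Filter.eventually_atTop.1 hev
  refine ⟨c, hc, max N0 0, fun x hx => ?_⟩
  rw [ncard_eq ((le_max_right _ _).trans hx)]
  exact hN x ((le_max_left _ _).trans hx)
end
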